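/- arXiv:math-ph/0502025 — 2 statements merged into one kernel-verified Lean document; each statement's English description precedes it below -/
import Mathlib

section
/- There exists a constant C > 0 such that for all α, α′ ∈ ℝ, all ε ≥ ε′ > 0, and every C¹ function g : 𝕋³ → ℂ, one has |∫_{𝕋³} [ 1/(α − e(p) + iε) − 1/(α′ − e(p) + iε′) ] g(p) dp| ≤ C ( ε^{−1/2} |α − α′| + ε^{1/2} ) ‖g‖_{C¹}. -/
open MeasureTheory Filter Topology

noncomputable section

/-- The torus `𝕋³ = [-1/2, 1/2]³` realized as a box in `ℝ³`. -/
def T3 : Set (Fin 3 → ℝ) := Set.pi Set.univ fun _ => Set.Icc (-(1/2) : ℝ) (1/2)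

/-- The lattice dispersion relation `e(p) = ∑_j (1 - cos(2π p_j))`. -/
def edisp (p : Fin 3 → ℝ) : ℝ := ∑ j, (1 - Real.cos (2 * Real.pi * p j))

/-- `Θ_ε(α) = ∫_{𝕋³} dq / (α - e(q) + iε)`. -/
def ThetaEps (ε α : ℝ) : ℂ := ∫ q in T3, ((α : ℂ) - (edisp q : ℂ) + (ε : ℂ) * Complex.I)⁻¹

/-- `Θ` is the limit of `Θ_ε` as `ε → 0⁺`. -/
def IsThetaLimit (Θ : ℝ → ℂ) : Prop :=
  ∀ α : ℝ, Tendsto (fun ε => ThetaEps ε α) (𝓝[>] (0 : ℝ)) (𝓝 (Θ α))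

/-- The renormalized dispersion `ω(p) = e(p) + λ² Θ(e(p))`. -/
def omegaR (Θ : ℝ → ℂ) (lam : ℝ) (p : Fin 3 → ℝ) : ℂ :=
  (edisp p : ℂ) + (lam : ℂ) ^ 2 * Θ (edisp p)

/-- A function on `𝕋³`, i.e. a `ℤ³`-periodic function on `ℝ³`. -/
def ZPeriodic (g : (Fin 3 → ℝ) → ℂ) : Prop :=
  ∀ (p : Fin 3 → ℝ) (n : Fin 3 → ℤ), g (p + fun j => (n j : ℝ)) = g p

/-- The `C¹` norm `‖g‖_∞ + ‖∇g‖_∞`. -/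
def C1Norm (g : (Fin 3 → ℝ) → ℂ) : ℝ :=
  (⨆ p : Fin 3 → ℝ, ‖g p‖) + ⨆ p : Fin 3 → ℝ, ‖fderiv ℝ g p‖

/-- `|||α||| = min {|α|, |α-2|, |α-3|, |α-4|, |α-6|}`. -/
def anorm (a : ℝ) : ℝ := min (min (min |a| |a - 2|) (min |a - 3| |a - 4|)) |a - 6|

/-- Distance between two points of the circle `ℝ/ℤ`. -/
def cdist (x y : ℝ) : ℝ := |x - y - (round (x - y) : ℝ)|

/-- `|||q||| = η + min {dist(q, γ) : γ a critical point of e}` (torus distance);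
the critical points are exactly the points with all coordinates in `{0, 1/2}` mod `1`,
and minimizing over them coordinatewise gives the formula below. -/
def tnorm (η : ℝ) (q : Fin 3 → ℝ) : ℝ :=
  η + Real.sqrt (∑ j, (min (cdist (q j) 0) (cdist (q j) (1/2))) ^ 2)

/-- `|∇e(q)|`, the Euclidean length of the gradient of the dispersion relation. -/
def gradNorm (q : Fin 3 → ℝ) : ℝ := Real.sqrt (∑ j, (2 * Real.pi * Real.sin (2 * Real.pi * q j)) ^ 2)
open scoped ENNReal

lemma aux_line (f : ℝ → ℝ≥0∞) (hf : Measurable f) (a : ℝ) :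
    ∫⁻ p : ℝ, f |p - a| = 2 * ∫⁻ x in Set.Ioi (0:ℝ), f x := by
  rw [lintegral_sub_right_eq_self (fun p : ℝ => f |p|) a]
  have h1 := lintegral_add_compl (μ := (volume : Measure ℝ)) (fun p : ℝ => f |p|)
    (measurableSet_Ioi (a := (0:ℝ)))
  rw [← h1, two_mul]
  congr 1
  · exact setLIntegral_congr_fun measurableSet_Ioi (fun x hx => by
      rw [abs_of_pos hx])
  · rw [Set.compl_Ioi, ← setLIntegral_congr (Iio_ae_eq_Iic (a := (0:ℝ)))]
    have h2 : MeasurePreserving (fun x : ℝ => -x) volume volume :=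
      Measure.measurePreserving_neg volume
    have h3 := h2.setLIntegral_comp_preimage (s := Set.Ioi (0:ℝ)) measurableSet_Ioi hf
    rw [← h3]
    have h4 : Set.preimage (fun x : ℝ => -x) (Set.Ioi 0) = Set.Iio 0 := by
      ext x; simp
    rw [h4]
    exact setLIntegral_congr_fun measurableSet_Iio (fun x hx => by
      rw [abs_of_neg hx])

lemma aux_lint_deriv (g g' : ℝ → ℝ) (l : ℝ) (hcont : ContinuousWithinAt g (Set.Ici 0) 0)
    (hderiv : ∀ x ∈ Set.Ioi (0:ℝ), HasDerivAt g (g' x) x)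
    (hpos : ∀ x ∈ Set.Ioi (0:ℝ), 0 ≤ g' x) (hg : Tendsto g atTop (𝓝 l)) :
    ∫⁻ x in Set.Ioi (0:ℝ), ENNReal.ofReal (g' x) = ENNReal.ofReal (l - g 0) := by
  rw [← integral_Ioi_of_hasDerivAt_of_nonneg hcont hderiv hpos hg,
    ofReal_integral_eq_lintegral_ofReal
      (integrableOn_Ioi_deriv_of_nonneg hcont hderiv hpos hg)]
  exact (ae_restrict_iff' measurableSet_Ioi).2 (Eventually.of_forall hpos)

lemma aux_k1 (δ : ℝ) (hδ : 0 < δ) :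
    ∫⁻ x in Set.Ioi (0:ℝ), ENNReal.ofReal ((x + δ) ^ (-(5/4) : ℝ)) =
      ENNReal.ofReal (4 * δ ^ (-(1/4) : ℝ)) := by
  have hd : ∀ x : ℝ, 0 ≤ x → HasDerivAt (fun x : ℝ => -4 * (x + δ) ^ (-(1/4) : ℝ))
      ((x + δ) ^ (-(5/4) : ℝ)) x := by
    intro x hx
    have h := (((hasDerivAt_id x).add_const δ).rpow_const (p := (-(1/4) : ℝ))
      (Or.inl (by simp only [id]; positivity))).const_mul (-4)
    refine h.congr_deriv ?_
    simp only [id]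
    norm_num
    ring
  rw [aux_lint_deriv (fun x : ℝ => -4 * (x + δ) ^ (-(1/4) : ℝ)) _ 0
    (hd 0 le_rfl).continuousAt.continuousWithinAt (fun x hx => hd x (le_of_lt hx))
    (fun x hx => Real.rpow_nonneg (by have : (0:ℝ) < x := hx; positivity) _)]
  · congr 1; simp
  · have h := (tendsto_rpow_neg_atTop (y := (1/4:ℝ)) (by norm_num)).comp
      (tendsto_atTop_add_const_right atTop δ tendsto_id)
    simpa using h.const_mul (-4)

lemma aux_k2 (δ : ℝ) (hδ : 0 < δ) :
    ∫⁻ x in Set.Ioi (0:ℝ), ENNReal.ofReal ((√x * (x + δ))⁻¹) =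
      ENNReal.ofReal (Real.pi / √δ) := by
  have hc : Continuous (fun x : ℝ => (2 / √δ) * Real.arctan (√(x / δ))) := by fun_prop
  have hs : 0 < √δ := Real.sqrt_pos.2 hδ
  rw [aux_lint_deriv (fun x : ℝ => (2 / √δ) * Real.arctan (√(x / δ))) _ (2 / √δ * (Real.pi / 2))
    hc.continuousAt.continuousWithinAt]
  · congr 1; simp; try ring
  · intro x hx
    have hx : 0 < x := hx
    have h := ((((hasDerivAt_id x).div_const δ).sqrt (by simp only [id]; positivity)).arctan).const_mul
      (2 / √δ)
    refine h.congr_deriv ?_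
    simp only [id]
    rw [Real.sq_sqrt (by positivity), Real.sqrt_div hx.le]
    have hx' : 0 < √x := Real.sqrt_pos.2 hx
    field_simp
    ring
  · intro x hx
    have hx : 0 < x := hx
    positivity
  · refine Tendsto.const_mul _ ?_
    have h1 : Tendsto (fun x : ℝ => √(x / δ)) atTop atTop :=
      Real.tendsto_sqrt_atTop.comp (tendsto_id.atTop_div_const hδ)
    exact (tendsto_nhds_of_tendsto_nhdsWithin Real.tendsto_arctan_atTop).comp h1

lemma aux_outer (δ : ℝ) (hδ : 0 < δ) :
    ∫⁻ p in Set.Icc (-(1/2) : ℝ) (1/2),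
      ENNReal.ofReal ((|Real.sin (2 * Real.pi * p)| + δ) ^ (-(5/4) : ℝ)) ≤
      ENNReal.ofReal (24 * δ ^ (-(1/4) : ℝ)) := by
  have hpi := Real.pi_pos
  set k : ℝ → ℝ≥0∞ := fun x => ENNReal.ofReal ((x + δ) ^ (-(5/4) : ℝ)) with hk
  have hkm : Measurable k := by fun_prop
  have hpt : ∀ p ∈ Set.Icc (-(1/2) : ℝ) (1/2),
      ENNReal.ofReal ((|Real.sin (2 * Real.pi * p)| + δ) ^ (-(5/4) : ℝ)) ≤
        k |p - 0| + k |p - 1/2| + k |p - (-(1/2))| := by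
    intro p hp
    have key : ∀ a : ℝ, |p - a| ≤ |Real.sin (2 * Real.pi * p)| →
        ENNReal.ofReal ((|Real.sin (2 * Real.pi * p)| + δ) ^ (-(5/4) : ℝ)) ≤ k |p - a| := by
      intro a ha
      apply ENNReal.ofReal_le_ofReal
      apply Real.rpow_le_rpow_of_nonpos (by positivity) (by linarith) (by norm_num)
    have hsin : ∀ x : ℝ, |x| ≤ 1/4 → |x| ≤ |Real.sin (2 * Real.pi * x)| := by
      intro x hx
      have h1 := Real.mul_le_sin (x := 2 * Real.pi * |x|) (by positivity) (by nlinarith)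
      have h2 : Real.sin (2 * Real.pi * |x|) ≤ |Real.sin (2 * Real.pi * x)| := by
        rcases abs_cases x with ⟨h, _⟩ | ⟨h, _⟩ <;> rw [h]
        · exact le_abs_self _
        · rw [mul_neg, Real.sin_neg]; exact neg_le_abs _
      have h3 : 2 / Real.pi * (2 * Real.pi * |x|) = 4 * |x| := by field_simp; ring
      have := abs_nonneg x
      linarith
    by_cases h1 : |p| ≤ 1/4
    · refine (key 0 (by simpa using hsin p h1)).trans ?_
      rw [add_assoc]; exact le_self_add
    · rcases le_total 0 p with h0 | h0
      · have h2 : |p - 1/2| ≤ |Real.sin (2 * Real.pi * p)| := by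
          have := hsin (p - 1/2) (by
            rw [abs_of_nonneg h0] at h1; rw [abs_le]; constructor <;> linarith [hp.2])
          rw [show 2 * Real.pi * (p - 1/2) = 2 * Real.pi * p - Real.pi by ring,
            Real.sin_sub_pi, abs_neg] at this
          exact this
        refine (key _ h2).trans ?_
        rw [add_assoc, add_left_comm]; exact le_self_add
      · have h2 : |p - (-(1/2))| ≤ |Real.sin (2 * Real.pi * p)| := by
          have := hsin (p + 1/2) (by
            rw [abs_of_nonpos h0] at h1; rw [abs_le]; constructor <;> linarith [hp.1])
          rw [show 2 * Real.pi * (p + 1/2) = 2 * Real.pi * p + Real.pi by ring,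
            Real.sin_add_pi, abs_neg] at this
          rw [sub_neg_eq_add]
          exact this
        refine (key _ h2).trans ?_
        exact le_add_self
  calc _ ≤ ∫⁻ p in Set.Icc (-(1/2) : ℝ) (1/2), (k |p - 0| + k |p - 1/2| + k |p - (-(1/2))|) :=
        setLIntegral_mono (by fun_prop) hpt
    _ ≤ ∫⁻ p, (k |p - 0| + k |p - 1/2| + k |p - (-(1/2))|) := setLIntegral_le_lintegral _ _
    _ = _ := by
        rw [lintegral_add_left (by fun_prop), lintegral_add_left (by fun_prop),
          aux_line k hkm, aux_line k hkm, aux_line k hkm, aux_k1 δ hδ]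
        have : (2 : ℝ≥0∞) = ENNReal.ofReal 2 := by simp
        rw [this, ← ENNReal.ofReal_mul (by norm_num),
          ← ENNReal.ofReal_add (by positivity) (by positivity),
          ← ENNReal.ofReal_add (by positivity) (by positivity)]
        congr 1; ring

lemma aux_pt (θ φ δ : ℝ) (hδ : 0 < δ) (h1 : 0 ≤ θ) (h2 : θ ≤ Real.pi) (h3 : 0 ≤ φ)
    (h4 : φ ≤ Real.pi) :
    √(Real.sin θ + δ) * (√|θ - φ| * (|θ - φ| + δ)) ≤ 14 * (|Real.cos θ - Real.cos φ| + δ ^ 2) := by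
  have hpi := Real.pi_pos
  have hpi4 := Real.pi_le_four
  set τ := |θ - φ| with hτ
  have hτ0 : 0 ≤ τ := abs_nonneg _
  have hτ1 : τ ≤ Real.pi := by rw [hτ, abs_le]; constructor <;> linarith
  set A := Real.sin ((θ + φ) / 2) with hA
  set B := Real.sin (τ / 2) with hB
  have hA0 : 0 ≤ A := Real.sin_nonneg_of_nonneg_of_le_pi (by linarith) (by linarith)
  have hB0 : 0 ≤ B := Real.sin_nonneg_of_nonneg_of_le_pi (by linarith) (by linarith)
  have hBτ : τ ≤ 4 * B := by
    have := Real.mul_le_sin (x := τ / 2) (by linarith) (by linarith)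
    have h5 : τ = Real.pi * (2 / Real.pi * (τ / 2)) := by field_simp
    nlinarith
  have hcos : |Real.cos θ - Real.cos φ| = 2 * A * B := by
    rw [Real.cos_sub_cos, abs_mul, abs_mul, ← hA, abs_of_nonneg hA0]
    have : |Real.sin ((θ - φ) / 2)| = B := by
      rw [hB, hτ]
      rcases abs_cases (θ - φ) with ⟨h, h'⟩ | ⟨h, h'⟩ <;> rw [h]
      · rw [abs_of_nonneg]
        exact Real.sin_nonneg_of_nonneg_of_le_pi (by linarith) (by linarith)
      · rw [neg_div, Real.sin_neg, abs_of_nonpos]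
        exact Real.sin_nonpos_of_nonpos_of_neg_pi_le (by linarith) (by linarith)
    rw [this]; norm_num
  have hs1 : 0 ≤ Real.sin θ := Real.sin_nonneg_of_nonneg_of_le_pi h1 h2
  have hs2 : 0 ≤ Real.sin φ := Real.sin_nonneg_of_nonneg_of_le_pi h3 h4
  have hAs : Real.sin θ ≤ 2 * A := by
    have h5 : Real.sin θ + Real.sin φ = 2 * A * Real.cos ((θ - φ) / 2) := by
      have ha := Real.sin_add ((θ + φ) / 2) ((θ - φ) / 2)
      have hb := Real.sin_sub ((θ + φ) / 2) ((θ - φ) / 2)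
      rw [show (θ + φ) / 2 + (θ - φ) / 2 = θ by ring] at ha
      rw [show (θ + φ) / 2 - (θ - φ) / 2 = φ by ring] at hb
      rw [ha, hb]; ring
    have := Real.cos_le_one ((θ - φ) / 2)
    nlinarith
  have hAB : B ≤ A := by
    rcases le_total ((θ + φ) / 2) (Real.pi / 2) with h | h
    · apply Real.sin_le_sin_of_le_of_le_pi_div_two <;> try linarith
      have : τ ≤ θ + φ := by rw [hτ, abs_le]; constructor <;> linarith
      linarith
    · rw [hA, ← Real.sin_pi_sub]
      apply Real.sin_le_sin_of_le_of_le_pi_div_two <;> try linarith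
      have : τ ≤ 2 * Real.pi - (θ + φ) := by rw [hτ, abs_le]; constructor <;> linarith
      linarith
  rw [hcos]
  set D := 2 * A * B + δ ^ 2 with hD
  have hBB : B ^ 2 ≤ A * B := by nlinarith
  have hττ : τ ^ 2 ≤ 16 * B ^ 2 := by nlinarith
  have e1 : (τ + δ) ^ 2 ≤ 16 * D := by nlinarith [sq_nonneg (τ - δ), sq_nonneg δ]
  have e2 : (Real.sin θ + δ) * τ ≤ 12 * D := by
    have : Real.sin θ * τ ≤ 2 * A * (4 * B) := mul_le_mul hAs hBτ hτ0 (by linarith)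
    nlinarith [sq_nonneg (τ - δ), sq_nonneg δ]
  have hD0 : 0 ≤ D := by positivity
  apply le_of_sq_le_sq _ (by positivity)
  rw [mul_pow, mul_pow, Real.sq_sqrt (by positivity), Real.sq_sqrt hτ0]
  calc (Real.sin θ + δ) * (τ * (τ + δ) ^ 2) = ((Real.sin θ + δ) * τ) * (τ + δ) ^ 2 := by ring
    _ ≤ (12 * D) * (16 * D) := mul_le_mul e2 e1 (by positivity) (by positivity)
    _ ≤ _ := by nlinarith [sq_nonneg D]

lemma aux_inner (δ y : ℝ) (hδ : 0 < δ) :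
    ∫⁻ p in Set.Icc (-(1/2) : ℝ) (1/2),
      ENNReal.ofReal (√(|Real.sin (2 * Real.pi * p)| + δ) /
        (|y + Real.cos (2 * Real.pi * p)| + δ ^ 2)) ≤
      ENNReal.ofReal (56 * Real.pi / √δ) := by
  have hpi := Real.pi_pos
  have hpi3 := Real.pi_gt_three
  set k : ℝ → ℝ≥0∞ := fun x => ENNReal.ofReal ((√x * (x + δ))⁻¹) with hk
  have hkm : Measurable k := by fun_prop
  obtain ⟨a, ha0, ha1, ha⟩ : ∃ a : ℝ, 0 ≤ a ∧ a ≤ 1/2 ∧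
      ∀ x, |x| ≤ 1 → |x - Real.cos (2 * Real.pi * a)| ≤ |y + x| := by
    refine ⟨Real.arccos (max (-1) (min 1 (-y))) / (2 * Real.pi), ?_, ?_, ?_⟩
    · have := Real.arccos_nonneg (max (-1) (min 1 (-y))); positivity
    · have := Real.arccos_le_pi (max (-1) (min 1 (-y)))
      rw [div_le_iff₀ (by positivity)]; linarith
    · intro x hx
      rw [mul_div_cancel₀ _ (by positivity), Real.cos_arccos (le_max_left _ _)
        (max_le (by norm_num) (min_le_left _ _))]
      rw [abs_le] at hx
      rcases max_cases (-1) (min 1 (-y)) with ⟨h, h'⟩ | ⟨h, h'⟩ <;> rw [h]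
      · rcases min_cases 1 (-y) with ⟨g, g'⟩ | ⟨g, g'⟩ <;>
        rcases abs_cases (x - -1) with ⟨u, u'⟩ | ⟨u, u'⟩ <;>
        rcases abs_cases (y + x) with ⟨w, w'⟩ | ⟨w, w'⟩ <;> linarith
      · rcases min_cases 1 (-y) with ⟨g, g'⟩ | ⟨g, g'⟩ <;> rw [g] <;> rw [g] at h'
        · rcases abs_cases (x - 1) with ⟨u, u'⟩ | ⟨u, u'⟩ <;>
          rcases abs_cases (y + x) with ⟨w, w'⟩ | ⟨w, w'⟩ <;> linarith
        · rw [sub_neg_eq_add, add_comm]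
  have hpt : ∀ p ∈ Set.Icc (-(1/2) : ℝ) (1/2), p ≠ a → p ≠ -a →
      ENNReal.ofReal (√(|Real.sin (2 * Real.pi * p)| + δ) /
        (|y + Real.cos (2 * Real.pi * p)| + δ ^ 2)) ≤
      ENNReal.ofReal 14 * (k |p - a| + k |p - (-a)|) := by
    intro p hp hpa hpa'
    have hpabs : |p| ≤ 1/2 := abs_le.2 hp
    set t := |(|p| - a)| with ht
    have ht0 : 0 < t := by
      rw [ht, abs_pos, sub_ne_zero]
      intro h
      rcases abs_cases p with ⟨u, _⟩ | ⟨u, _⟩ <;> rw [u] at h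
      · exact hpa h
      · exact hpa' (by linarith)
    have hkt : k t ≤ k |p - a| + k |p - (-a)| := by
      rcases abs_cases p with ⟨u, _⟩ | ⟨u, _⟩ <;> rw [ht, u]
      · exact le_self_add
      · rw [show -p - a = -(p - -a) by ring, abs_neg]; exact le_add_self
    refine le_trans ?_ (mul_le_mul_right hkt _)
    rw [hk, ← ENNReal.ofReal_mul (by norm_num)]
    apply ENNReal.ofReal_le_ofReal
    have hcos : Real.cos (2 * Real.pi * p) = Real.cos (2 * Real.pi * |p|) := by
      rcases abs_cases p with ⟨u, _⟩ | ⟨u, _⟩ <;> rw [u]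
      rw [mul_neg, Real.cos_neg]
    have hsin : |Real.sin (2 * Real.pi * p)| = Real.sin (2 * Real.pi * |p|) := by
      have h0 : 0 ≤ Real.sin (2 * Real.pi * |p|) :=
        Real.sin_nonneg_of_nonneg_of_le_pi (by positivity) (by nlinarith)
      rw [← abs_of_nonneg h0]
      rcases abs_cases p with ⟨u, _⟩ | ⟨u, _⟩ <;> rw [u]
      rw [mul_neg, Real.sin_neg, abs_neg]
    have h5 := aux_pt (2 * Real.pi * |p|) (2 * Real.pi * a) δ hδ (by positivity) (by nlinarith)
      (by positivity) (by nlinarith)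
    have h6 := ha _ (Real.abs_cos_le_one (2 * Real.pi * p))
    rw [hcos] at h6 ⊢
    rw [hsin]
    have h7 : |2 * Real.pi * |p| - 2 * Real.pi * a| = 2 * Real.pi * t := by
      rw [← mul_sub, abs_mul, abs_of_pos (by positivity : 0 < 2 * Real.pi)]
    rw [h7] at h5
    have h8 : t ≤ 2 * Real.pi * t := by nlinarith
    have h9 : √t ≤ √(2 * Real.pi * t) := Real.sqrt_le_sqrt h8
    have h10 : √t * (t + δ) ≤ √(2 * Real.pi * t) * (2 * Real.pi * t + δ) :=
      mul_le_mul h9 (by linarith) (by positivity) (by positivity)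
    have hst : 0 < √t := Real.sqrt_pos.2 ht0
    rw [← div_eq_mul_inv, div_le_div_iff₀ (by positivity) (by positivity)]
    calc _ ≤ √(Real.sin (2 * Real.pi * |p|) + δ) *
          (√(2 * Real.pi * t) * (2 * Real.pi * t + δ)) :=
          mul_le_mul_of_nonneg_left h10 (by positivity)
      _ ≤ _ := by linarith
  have hnull : ∀ᵐ p : ℝ, p ≠ a ∧ p ≠ -a := by
    have h1 : ∀ c : ℝ, ∀ᵐ p : ℝ, p ≠ c := fun c => by
      simp [ae_iff]
    exact (h1 a).and (h1 (-a))
  calc _ ≤ ∫⁻ p in Set.Icc (-(1/2) : ℝ) (1/2),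
          ENNReal.ofReal 14 * (k |p - a| + k |p - (-a)|) := by
        apply lintegral_mono_ae
        filter_upwards [ae_restrict_mem measurableSet_Icc, ae_restrict_of_ae hnull] with p hp hp'
        exact hpt p hp hp'.1 hp'.2
    _ ≤ ∫⁻ p, ENNReal.ofReal 14 * (k |p - a| + k |p - (-a)|) := setLIntegral_le_lintegral _ _
    _ = _ := by
        rw [lintegral_const_mul _ (by fun_prop), lintegral_add_left (by fun_prop),
          aux_line k hkm, aux_line k hkm, aux_k2 δ hδ]
        have : (2 : ℝ≥0∞) = ENNReal.ofReal 2 := by simp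
        have hs : 0 < √δ := Real.sqrt_pos.2 hδ
        rw [this, ← ENNReal.ofReal_mul (by norm_num),
          ← ENNReal.ofReal_add (by positivity) (by positivity),
          ← ENNReal.ofReal_mul (by norm_num)]
        congr 1; ring

lemma aux_w (v : Fin 3 → ℝ) (hv : ∀ j, 0 < v j) (S : ℝ) (hS : ∀ j, (v j) ^ 2 ≤ 2 * S) :
    S⁻¹ ≤ ∑ j, 2 * (√(v j) * ∏ i : Fin 2, (v (j.succAbove i)) ^ (-(5/4) : ℝ)) := by
  obtain ⟨j, hj⟩ := Finite.exists_max v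
  have h0 : ∀ j, 0 ≤ 2 * (√(v j) * ∏ i : Fin 2, (v (j.succAbove i)) ^ (-(5/4) : ℝ)) := by
    intro j
    have : ∀ i, 0 ≤ (v i) ^ (-(5/4) : ℝ) := fun i => Real.rpow_nonneg (hv i).le _
    have := Finset.prod_nonneg (s := Finset.univ) (fun (i : Fin 2) _ => this (j.succAbove i))
    positivity
  refine le_trans ?_ (Finset.single_le_sum (fun j _ => h0 j) (Finset.mem_univ j))
  have hvj := hv j
  have h1 : ∀ i, (v j) ^ (-(5/4) : ℝ) ≤ (v i) ^ (-(5/4) : ℝ) := fun i =>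
    Real.rpow_le_rpow_of_nonpos (hv i) (hj i) (by norm_num)
  have h2 : 0 ≤ (v j) ^ (-(5/4) : ℝ) := Real.rpow_nonneg hvj.le _
  rw [Fin.prod_univ_two]
  have h3 : √(v j) * ((v j) ^ (-(5/4) : ℝ) * (v j) ^ (-(5/4) : ℝ)) = ((v j) ^ 2)⁻¹ := by
    rw [Real.sqrt_eq_rpow, ← Real.rpow_add hvj, ← Real.rpow_add hvj]
    norm_num
  have h4 : S⁻¹ ≤ 2 * ((v j) ^ 2)⁻¹ := by
    have := hS j
    have hp : 0 < (v j) ^ 2 := by positivity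
    have : 0 < S := by linarith
    rw [← div_eq_mul_inv, inv_eq_one_div, div_le_div_iff₀ (by positivity) (by positivity)]
    linarith
  refine h4.trans ?_
  rw [← h3]
  have h5 : (v j) ^ (-(5/4) : ℝ) * (v j) ^ (-(5/4) : ℝ) ≤
      (v (j.succAbove 0)) ^ (-(5/4) : ℝ) * (v (j.succAbove 1)) ^ (-(5/4) : ℝ) :=
    mul_le_mul (h1 _) (h1 _) h2 (h2.trans (h1 _))
  have h6 := mul_le_mul_of_nonneg_left h5 (Real.sqrt_nonneg (v j))
  linarith

/-- The weight `∑ sin²`. -/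
def ssum (p : Fin 3 → ℝ) : ℝ := ∑ j, (Real.sin (2 * Real.pi * p j)) ^ 2

lemma ssum_nonneg (p : Fin 3 → ℝ) : 0 ≤ ssum p := Finset.sum_nonneg fun _ _ => sq_nonneg _

lemma aux_res (x ε : ℝ) (hε : 0 < ε) :
    ‖((x : ℂ) + (ε : ℂ) * Complex.I)⁻¹‖ ≤ 2 / (|x| + ε) := by
  rw [norm_inv]
  have h1 := Complex.abs_re_le_norm ((x : ℂ) + (ε : ℂ) * Complex.I)
  have h2 := Complex.abs_im_le_norm ((x : ℂ) + (ε : ℂ) * Complex.I)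
  simp at h1 h2
  rw [abs_of_pos hε] at h2
  have h3 : 0 < |x| + ε := by positivity
  rw [inv_eq_one_div, div_le_div_iff₀ (by linarith) h3]
  linarith

lemma aux_fac (δ α : ℝ) (hδ : 0 < δ) (j : Fin 3) :
    ∫⁻ p in T3, ENNReal.ofReal (√(|Real.sin (2 * Real.pi * p j)| + δ) /
        (|(α - 3 + ∑ i : Fin 2, Real.cos (2 * Real.pi * p (j.succAbove i))) +
          Real.cos (2 * Real.pi * p j)| + δ ^ 2)) *
      ∏ i : Fin 2, ENNReal.ofReal
        ((|Real.sin (2 * Real.pi * p (j.succAbove i))| + δ) ^ (-(5/4) : ℝ)) ≤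
    ENNReal.ofReal (56 * Real.pi / √δ) * (ENNReal.ofReal (24 * δ ^ (-(1/4) : ℝ)) *
      ENNReal.ofReal (24 * δ ^ (-(1/4) : ℝ))) := by
  set μ : Measure ℝ := volume.restrict (Set.Icc (-(1/2) : ℝ) (1/2)) with hμ
  have hT : (volume : Measure (Fin 3 → ℝ)).restrict T3 = Measure.pi fun _ => μ := by
    rw [T3, volume_pi, Measure.restrict_pi_pi]
  rw [hT]
  set F : ℝ → ℝ → ℝ≥0∞ := fun y p => ENNReal.ofReal (√(|Real.sin (2 * Real.pi * p)| + δ) /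
        (|y + Real.cos (2 * Real.pi * p)| + δ ^ 2)) with hF
  set G : ℝ → ℝ≥0∞ := fun p => ENNReal.ofReal
        ((|Real.sin (2 * Real.pi * p)| + δ) ^ (-(5/4) : ℝ)) with hG
  have hFm : Measurable (fun z : ℝ × ℝ => F z.1 z.2) := by fun_prop
  have hGm : Measurable G := by fun_prop
  set H : ℝ × (Fin 2 → ℝ) → ℝ≥0∞ := fun z =>
    F (α - 3 + ∑ i : Fin 2, Real.cos (2 * Real.pi * z.2 i)) z.1 * ∏ i : Fin 2, G (z.2 i) with hH
  have hHm : Measurable H := by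
    have m1 := hFm.comp (g := fun z : ℝ × ℝ => F z.1 z.2)
        (f := fun z : ℝ × (Fin 2 → ℝ) =>
          (α - 3 + ∑ i : Fin 2, Real.cos (2 * Real.pi * z.2 i), z.1)) (by fun_prop)
    have m2 : Measurable (fun z : ℝ × (Fin 2 → ℝ) => ∏ i : Fin 2, G (z.2 i)) := by fun_prop
    exact m1.mul m2
  have hmp := measurePreserving_piFinSuccAbove (n := 2) (fun _ : Fin 3 => μ) j
  have e1 := hmp.lintegral_comp hHm
  have e2 : ∫⁻ p, H ((MeasurableEquiv.piFinSuccAbove (fun _ : Fin 3 => ℝ) j) p)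
      ∂(Measure.pi fun _ => μ) = _ := e1
  have e3 : ∀ p : Fin 3 → ℝ, H ((MeasurableEquiv.piFinSuccAbove (fun _ : Fin 3 => ℝ) j) p) =
      F (α - 3 + ∑ i : Fin 2, Real.cos (2 * Real.pi * p (j.succAbove i))) (p j) *
        ∏ i : Fin 2, G (p (j.succAbove i)) := fun p => rfl
  simp_rw [e3] at e2
  change ∫⁻ p, F (α - 3 + ∑ i : Fin 2, Real.cos (2 * Real.pi * p (j.succAbove i))) (p j) *
        ∏ i : Fin 2, G (p (j.succAbove i)) ∂(Measure.pi fun _ => μ) ≤ _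
  rw [e2, lintegral_prod_symm' _ hHm]
  have e4 : ∀ q : Fin 2 → ℝ, ∫⁻ x, H (x, q) ∂μ ≤
      ENNReal.ofReal (56 * Real.pi / √δ) * ∏ i : Fin 2, G (q i) := by
    intro q
    simp only [hH]
    rw [lintegral_mul_const _ (by fun_prop)]
    exact mul_le_mul_left (aux_inner δ _ hδ) _
  refine (lintegral_mono e4).trans ?_
  rw [lintegral_const_mul _ (by fun_prop)]
  refine mul_le_mul_right ?_ _
  have hmp2 := measurePreserving_finTwoArrow μ
  have e5 := hmp2.lintegral_comp (f := fun z : ℝ × ℝ => G z.1 * G z.2) (by fun_prop)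
  have e6 : ∫⁻ q : Fin 2 → ℝ, ∏ i : Fin 2, G (q i) ∂(Measure.pi fun _ => μ) =
      ∫⁻ z : ℝ × ℝ, G z.1 * G z.2 ∂(μ.prod μ) := by
    rw [← e5]
    refine lintegral_congr fun q => ?_
    rw [Fin.prod_univ_two]; rfl
  rw [e6, lintegral_prod_mul hGm.aemeasurable hGm.aemeasurable]
  exact mul_le_mul' (aux_outer δ hδ) (aux_outer δ hδ)

lemma aux_K (ε α : ℝ) (hε : 0 < ε) :
    ∫⁻ p in T3, ENNReal.ofReal ((ssum p + ε)⁻¹ *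
      ‖((α : ℂ) - (edisp p : ℂ) + (ε : ℂ) * Complex.I)⁻¹‖) ≤
      ENNReal.ofReal (12 * 56 * Real.pi * 24 * 24 * ε ^ (-(1/2) : ℝ)) := by
  set δ := √ε with hδd
  have hδ : 0 < δ := Real.sqrt_pos.2 hε
  have hδ2 : δ ^ 2 = ε := Real.sq_sqrt hε.le
  have hpi := Real.pi_pos
  have hpt : ∀ p : Fin 3 → ℝ, ENNReal.ofReal ((ssum p + ε)⁻¹ *
      ‖((α : ℂ) - (edisp p : ℂ) + (ε : ℂ) * Complex.I)⁻¹‖) ≤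
      ∑ j, ENNReal.ofReal 4 * (ENNReal.ofReal (√(|Real.sin (2 * Real.pi * p j)| + δ) /
        (|(α - 3 + ∑ i : Fin 2, Real.cos (2 * Real.pi * p (j.succAbove i))) +
          Real.cos (2 * Real.pi * p j)| + δ ^ 2)) *
      ∏ i : Fin 2, ENNReal.ofReal
        ((|Real.sin (2 * Real.pi * p (j.succAbove i))| + δ) ^ (-(5/4) : ℝ))) := by
    intro p
    set v : Fin 3 → ℝ := fun j => |Real.sin (2 * Real.pi * p j)| + δ with hv
    have hv0 : ∀ j, 0 < v j := fun j => by positivity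
    have h1 := aux_w v hv0 (ssum p + ε) (fun j => by
      have h2 : (Real.sin (2 * Real.pi * p j)) ^ 2 ≤ ssum p :=
        Finset.single_le_sum (f := fun j => (Real.sin (2 * Real.pi * p j)) ^ 2)
          (fun i _ => sq_nonneg _) (Finset.mem_univ j)
      simp only [hv]
      rw [← hδ2]
      nlinarith [sq_nonneg (|Real.sin (2 * Real.pi * p j)| - δ),
        sq_abs (Real.sin (2 * Real.pi * p j))])
    have h3 := aux_res (α - edisp p) ε hε
    rw [Complex.ofReal_sub] at h3
    have h4 := mul_le_mul h1 h3 (norm_nonneg _) (le_trans (by have := ssum_nonneg p; positivity) h1)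
    refine (ENNReal.ofReal_le_ofReal h4).trans ?_
    rw [Finset.sum_mul, ENNReal.ofReal_sum_of_nonneg]
    · refine Finset.sum_le_sum fun j _ => ?_
      rw [← ENNReal.ofReal_prod_of_nonneg (fun i _ => Real.rpow_nonneg (hv0 _).le _),
        ← ENNReal.ofReal_mul (by positivity), ← ENNReal.ofReal_mul (by positivity)]
      apply ENNReal.ofReal_le_ofReal
      have h5 : (α - 3 + ∑ i : Fin 2, Real.cos (2 * Real.pi * p (j.succAbove i))) +
          Real.cos (2 * Real.pi * p j) = α - edisp p := by
        have := Fin.sum_univ_succAbove (fun i => Real.cos (2 * Real.pi * p i)) j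
        simp only [edisp, Finset.sum_sub_distrib]
        rw [this]
        simp
        ring
      rw [h5, hδ2]
      apply le_of_eq
      simp only [hv]
      ring
    · intro j _
      have : 0 ≤ ∏ i : Fin 2, (v (j.succAbove i)) ^ (-(5/4) : ℝ) :=
        Finset.prod_nonneg fun i _ => Real.rpow_nonneg (hv0 _).le _
      positivity
  refine (lintegral_mono hpt).trans ?_
  rw [lintegral_finsetSum']
  · have h6 : ∀ j : Fin 3, _ := fun j => aux_fac δ α hδ j
    calc _ ≤ ∑ j : Fin 3, ENNReal.ofReal 4 * (ENNReal.ofReal (56 * Real.pi / √δ) *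
        (ENNReal.ofReal (24 * δ ^ (-(1/4) : ℝ)) * ENNReal.ofReal (24 * δ ^ (-(1/4) : ℝ)))) := by
          refine Finset.sum_le_sum fun j _ => ?_
          rw [lintegral_const_mul' _ _ ENNReal.ofReal_ne_top]
          exact mul_le_mul_right (aux_fac δ α hδ j) _
      _ = _ := by
          have h7 : 0 < √δ := Real.sqrt_pos.2 hδ
          have h8 : 0 ≤ δ ^ (-(1/4) : ℝ) := Real.rpow_nonneg hδ.le _
          rw [← ENNReal.ofReal_mul (by positivity), ← ENNReal.ofReal_mul (by positivity),
            ← ENNReal.ofReal_mul (by positivity), ← ENNReal.ofReal_sum_of_nonneg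
              (fun _ _ => by positivity)]
          congr 1
          simp only [Finset.sum_const, Finset.card_univ, Fintype.card_fin, nsmul_eq_mul]
          have h9 : (√δ)⁻¹ * (δ ^ (-(1/4) : ℝ) * δ ^ (-(1/4) : ℝ)) = ε ^ (-(1/2) : ℝ) := by
            rw [← hδ2, ← Real.rpow_natCast, ← Real.rpow_mul hδ.le, Real.sqrt_eq_rpow,
              ← Real.rpow_neg hδ.le, ← Real.rpow_add hδ, ← Real.rpow_add hδ]
            norm_num
          rw [← h9]
          push_cast
          ring
  · intro j _
    fun_prop

/-- The resolvent factor. -/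
def resv (α ε : ℝ) (p : Fin 3 → ℝ) : ℂ := ((α : ℂ) - (edisp p : ℂ) + (ε : ℂ) * Complex.I)⁻¹

lemma resv_den_ne (α ε : ℝ) (hε : 0 < ε) (x : ℝ) :
    (α : ℂ) - (x : ℂ) + (ε : ℂ) * Complex.I ≠ 0 := by
  intro h
  have := congrArg Complex.im h
  simp at this
  exact hε.ne' this

lemma edisp_contDiff : ContDiff ℝ 1 edisp := by unfold edisp; fun_prop

lemma ssum_contDiff : ContDiff ℝ 1 ssum := by unfold ssum; fun_prop

lemma resv_contDiff (α ε : ℝ) (hε : 0 < ε) : ContDiff ℝ 1 (resv α ε) := by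
  unfold resv
  have h : ContDiff ℝ 1 (fun p => (edisp p : ℂ)) :=
    Complex.ofRealCLM.contDiff.comp edisp_contDiff
  exact ((contDiff_const.sub h).add contDiff_const).inv fun p => resv_den_ne α ε hε _

lemma weight_contDiff (ε : ℝ) (hε : 0 < ε) : ContDiff ℝ 1 (fun p => (ssum p + ε)⁻¹) :=
  (ssum_contDiff.add contDiff_const).inv fun p => by
    have := ssum_nonneg p; positivity

/-- The vector field used for the integration by parts. -/
def vfield (g : (Fin 3 → ℝ) → ℂ) (α ε : ℝ) (j : Fin 3) (p : Fin 3 → ℝ) : ℂ :=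
  g p * ((Real.sin (2 * Real.pi * p j) * (ssum p + ε)⁻¹ : ℝ) : ℂ) * resv α ε p

lemma vfield_contDiff (g : (Fin 3 → ℝ) → ℂ) (hg : ContDiff ℝ 1 g) (α ε : ℝ) (hε : 0 < ε)
    (j : Fin 3) : ContDiff ℝ 1 (vfield g α ε j) := by
  unfold vfield
  have h1 : ContDiff ℝ 1 (fun p : Fin 3 → ℝ => Real.sin (2 * Real.pi * p j) * (ssum p + ε)⁻¹) :=
    ContDiff.mul (by fun_prop) (weight_contDiff ε hε)
  exact (hg.mul (Complex.ofRealCLM.contDiff.comp h1)).mul (resv_contDiff α ε hε)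

lemma line_sum (φ φ' : ℝ → ℝ) (hφ : ∀ x, HasDerivAt φ (φ' x) x) (p : Fin 3 → ℝ) (j : Fin 3) :
    HasDerivAt (fun t : ℝ => ∑ i, φ ((p + t • (Pi.single j 1 : Fin 3 → ℝ)) i)) (φ' (p j)) 0 := by
  have h : ∀ i ∈ Finset.univ, HasDerivAt
      (fun t : ℝ => φ ((p + t • (Pi.single j 1 : Fin 3 → ℝ)) i))
      (φ' (p i) * (Pi.single j 1 : Fin 3 → ℝ) i) 0 := by
    intro i _
    have h1 : HasDerivAt (fun t : ℝ => (p + t • (Pi.single j 1 : Fin 3 → ℝ)) i)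
        ((Pi.single j 1 : Fin 3 → ℝ) i) 0 := by
      simpa using ((hasDerivAt_id (0:ℝ)).mul_const ((Pi.single j 1 : Fin 3 → ℝ) i)).const_add (p i)
    have h2 := HasDerivAt.comp (h₂ := φ) (0:ℝ) (by simpa using hφ (p i)) h1
    exact h2
  refine (HasDerivAt.fun_sum h).congr_deriv ?_
  rw [Finset.sum_eq_single j]
  · simp
  · intro i _ hij; simp [hij]
  · simp

lemma vfield_deriv (g : (Fin 3 → ℝ) → ℂ) (hg : ContDiff ℝ 1 g) (α ε : ℝ) (hε : 0 < ε)
    (j : Fin 3) (p : Fin 3 → ℝ) :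
    fderiv ℝ (vfield g α ε j) p (Pi.single j 1) =
      (fderiv ℝ g p (Pi.single j 1) * ((Real.sin (2 * Real.pi * p j) * (ssum p + ε)⁻¹ : ℝ) : ℂ) +
        g p * ((2 * Real.pi * Real.cos (2 * Real.pi * p j) * (ssum p + ε)⁻¹ -
          4 * Real.pi * (Real.sin (2 * Real.pi * p j)) ^ 2 * Real.cos (2 * Real.pi * p j) *
            (ssum p + ε)⁻¹ ^ 2 : ℝ) : ℂ)) * resv α ε p +
      2 * Real.pi * (g p * ((Real.sin (2 * Real.pi * p j) ^ 2 * (ssum p + ε)⁻¹ : ℝ) : ℂ)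
        * resv α ε p ^ 2) := by
  set v : Fin 3 → ℝ := Pi.single j 1 with hv
  have hline : HasDerivAt (fun t : ℝ => p + t • v) v 0 := by
    simpa using ((hasDerivAt_id (0:ℝ)).smul_const v).const_add p
  have hp0 : p + (0:ℝ) • v = p := by simp
  have hsin : ∀ x : ℝ, HasDerivAt (fun x => Real.sin (2 * Real.pi * x))
      (2 * Real.pi * Real.cos (2 * Real.pi * x)) x := by
    intro x
    refine (((hasDerivAt_id x).const_mul (2 * Real.pi)).sin).congr_deriv ?_
    simp; ring
  have hcos : ∀ x : ℝ, HasDerivAt (fun x => 1 - Real.cos (2 * Real.pi * x))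
      (2 * Real.pi * Real.sin (2 * Real.pi * x)) x := by
    intro x
    refine ((((hasDerivAt_id x).const_mul (2 * Real.pi)).cos).const_sub 1).congr_deriv ?_
    simp; ring
  have dG : HasDerivAt (fun t : ℝ => g (p + t • v)) (fderiv ℝ g p v) 0 := by
    have h := (hg.differentiable one_ne_zero p).hasFDerivAt
    rw [← hp0] at h
    have := h.comp_hasDerivAt (0:ℝ) hline
    rw [hp0] at this
    exact this
  have dV : HasDerivAt (fun t : ℝ => vfield g α ε j (p + t • v))
      (fderiv ℝ (vfield g α ε j) p v) 0 := by
    have h := ((vfield_contDiff g hg α ε hε j).differentiable one_ne_zero p).hasFDerivAt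
    rw [← hp0] at h
    have := h.comp_hasDerivAt (0:ℝ) hline
    rw [hp0] at this
    exact this
  have dE : HasDerivAt (fun t : ℝ => edisp (p + t • v))
      (2 * Real.pi * Real.sin (2 * Real.pi * p j)) 0 := line_sum _ _ hcos p j
  have dS : HasDerivAt (fun t : ℝ => ssum (p + t • v))
      (2 * Real.sin (2 * Real.pi * p j) * (2 * Real.pi * Real.cos (2 * Real.pi * p j))) 0 :=
    line_sum (fun x => Real.sin (2 * Real.pi * x) ^ 2)
      (fun x => 2 * Real.sin (2 * Real.pi * x) * (2 * Real.pi * Real.cos (2 * Real.pi * x)))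
      (fun x => ((hsin x).pow 2).congr_deriv (by norm_num)) p j
  have dJ : HasDerivAt (fun t : ℝ => Real.sin (2 * Real.pi * (p + t • v) j))
      (2 * Real.pi * Real.cos (2 * Real.pi * p j)) 0 := by
    have h1 : HasDerivAt (fun t : ℝ => (p + t • v) j) 1 0 := by
      simpa [hv] using (hasDerivAt_id (0:ℝ)).const_add (p j)
    have h2 := HasDerivAt.comp (h₂ := fun x => Real.sin (2 * Real.pi * x)) (0:ℝ)
      (by simpa using hsin (p j)) h1
    exact h2.congr_deriv (by simp)
  have hS0 : ssum p + ε ≠ 0 := by have := ssum_nonneg p; positivity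
  have dW := (dS.add_const ε).inv (by simpa using hS0)
  have dR := (((dE.ofReal_comp).const_sub (α : ℂ)).add_const ((ε : ℂ) * Complex.I)).inv
    (resv_den_ne α ε hε _)
  have dT := (dG.mul ((dJ.mul dW).ofReal_comp)).mul dR
  have hu := dV.unique dT
  rw [hu]
  simp only [hp0, resv, Pi.mul_apply, Pi.inv_apply]
  have hz := resv_den_ne α ε hε (edisp p)
  push_cast
  have hS1 : (ssum p : ℂ) + (ε : ℂ) ≠ 0 := by exact_mod_cast hS0
  field_simp
  ring

lemma aux_div (g : (Fin 3 → ℝ) → ℂ) (hg : ContDiff ℝ 1 g) (α ε : ℝ) (hε : 0 < ε) :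
    IntegrableOn (fun p => ∑ j, fderiv ℝ (vfield g α ε j) p (Pi.single j 1)) T3 ∧
    ∫ p in T3, ∑ j, fderiv ℝ (vfield g α ε j) p (Pi.single j 1) = 0 := by
  have hT : T3 = Set.Icc (fun _ => -(1/2) : Fin 3 → ℝ) (fun _ => 1/2) := by
    rw [T3, Set.pi_univ_Icc]
  have hc : Continuous (fun p => ∑ j, fderiv ℝ (vfield g α ε j) p (Pi.single j 1)) := by
    refine continuous_finsetSum _ fun j _ => ?_
    exact ((vfield_contDiff g hg α ε hε j).continuous_fderiv one_ne_zero).clm_apply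
      continuous_const
  rw [hT]
  have hi := hc.continuousOn.integrableOn_compact (μ := volume) (isCompact_Icc
    (a := (fun _ => -(1/2) : Fin 3 → ℝ)) (b := fun _ => 1/2))
  refine ⟨hi, ?_⟩
  rw [integral_divergence_of_hasFDerivAt_off_countable' (n := 2)
    (fun _ => -(1/2) : Fin 3 → ℝ) (fun _ => 1/2) (fun i => by norm_num)
    (fun j => vfield g α ε j) (fun j p => fderiv ℝ (vfield g α ε j) p) ∅ Set.countable_empty
    (fun j => (vfield_contDiff g hg α ε hε j).continuous.continuousOn)
    (fun p _ j => ((vfield_contDiff g hg α ε hε j).differentiable one_ne_zero p).hasFDerivAt) hi]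
  refine Finset.sum_eq_zero fun j _ => ?_
  have h1 : Real.sin (2 * Real.pi * (1/2)) = 0 := by
    rw [show 2 * Real.pi * (1/2) = Real.pi by ring, Real.sin_pi]
  have h2 : Real.sin (2 * Real.pi * (-(1/2))) = 0 := by
    rw [show 2 * Real.pi * (-(1/2)) = -Real.pi by ring, Real.sin_neg, Real.sin_pi, neg_zero]
  simp only [vfield, Fin.insertNth_apply_same, h1, h2]
  simp

lemma aux_main (g : (Fin 3 → ℝ) → ℂ) (hg : ContDiff ℝ 1 g) (M : ℝ) (hM : ∀ p, ‖g p‖ ≤ M)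
    (hM' : ∀ p, ‖fderiv ℝ g p‖ ≤ M) (α ε : ℝ) (hε : 0 < ε) :
    ‖∫ p in T3, g p * resv α ε p ^ 2‖ ≤
      (3 + 12 * Real.pi) * (12 * 56 * Real.pi * 24 * 24 * ε ^ (-(1/2) : ℝ)) * M := by
  have hpi := Real.pi_pos
  have hpi3 := Real.pi_gt_three
  have hM0 : 0 ≤ M := (norm_nonneg _).trans (hM 0)
  have hK0 : 0 ≤ 12 * 56 * Real.pi * 24 * 24 * ε ^ (-(1/2) : ℝ) := by positivity
  obtain ⟨hi, h0⟩ := aux_div g hg α ε hε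
  have hTc : IsCompact T3 := by
    rw [T3, Set.pi_univ_Icc]; exact isCompact_Icc
  have hgR : IntegrableOn (fun p => 2 * Real.pi * (g p * resv α ε p ^ 2)) T3 := by
    apply ContinuousOn.integrableOn_compact hTc
    have h1 := hg.continuous
    have h2 := (resv_contDiff α ε hε).continuous
    fun_prop
  have hIntEq : 2 * Real.pi * ∫ p in T3, g p * resv α ε p ^ 2 =
      ∫ p in T3, (2 * Real.pi * (g p * resv α ε p ^ 2) -
        ∑ j, fderiv ℝ (vfield g α ε j) p (Pi.single j 1)) := by
    rw [integral_sub hgR hi, h0, sub_zero, integral_const_mul]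
  have hpt : ∀ p, ‖2 * Real.pi * (g p * resv α ε p ^ 2) -
        ∑ j, fderiv ℝ (vfield g α ε j) p (Pi.single j 1)‖ ≤
      (3 + 12 * Real.pi) * M * ((ssum p + ε)⁻¹ * ‖resv α ε p‖) := by
    intro p
    simp only [vfield_deriv g hg α ε hε]
    set W := (ssum p + ε)⁻¹ with hW
    set R := resv α ε p with hR
    have hs0 := ssum_nonneg p
    have hW0 : 0 < W := by positivity
    have hWs : ssum p * W ≤ 1 := by
      rw [hW, ← div_eq_mul_inv, div_le_one (by positivity)]; linarith
    have hW1 : (ssum p + ε) * W = 1 := mul_inv_cancel₀ (by positivity)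
    have hεR : ε * ‖R‖ ≤ 1 := by
      have h2 := Complex.abs_im_le_norm ((α : ℂ) - (edisp p : ℂ) + (ε : ℂ) * Complex.I)
      simp at h2
      rw [abs_of_pos hε] at h2
      rw [hR, resv, norm_inv, ← div_eq_mul_inv, div_le_one (by linarith)]
      exact h2
    set D : Fin 3 → ℂ := fun j => fderiv ℝ g p (Pi.single j 1) with hD
    set s : Fin 3 → ℝ := fun j => Real.sin (2 * Real.pi * p j) with hs
    set c : Fin 3 → ℝ := fun j => Real.cos (2 * Real.pi * p j) with hc
    have hDM : ∀ j, ‖D j‖ ≤ M := by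
      intro j
      refine ((fderiv ℝ g p).le_opNorm _).trans ?_
      simpa [Pi.norm_single] using hM' p
    have hs1 : ∀ j, |s j| ≤ 1 := fun j => Real.abs_sin_le_one _
    have hc1 : ∀ j, |c j| ≤ 1 := fun j => Real.abs_cos_le_one _
    have hss : ssum p = ∑ j, s j ^ 2 := rfl
    have hid : 2 * Real.pi * (g p * R ^ 2) - ∑ j, ((D j * ((s j * W : ℝ) : ℂ) +
        g p * ((2 * Real.pi * c j * W - 4 * Real.pi * s j ^ 2 * c j * W ^ 2 : ℝ) : ℂ)) * R +
        2 * Real.pi * (g p * ((s j ^ 2 * W : ℝ) : ℂ) * R ^ 2)) =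
        2 * Real.pi * g p * ((ε * W : ℝ) : ℂ) * R ^ 2 - ∑ j, ((D j * ((s j * W : ℝ) : ℂ) +
        g p * ((2 * Real.pi * c j * W - 4 * Real.pi * s j ^ 2 * c j * W ^ 2 : ℝ) : ℂ)) * R) := by
      rw [Finset.sum_add_distrib]
      have h1 : ∑ j, 2 * (Real.pi : ℂ) * (g p * ((s j ^ 2 * W : ℝ) : ℂ) * R ^ 2) =
          2 * Real.pi * (g p * ((ssum p * W : ℝ) : ℂ) * R ^ 2) := by
        rw [hss]; push_cast; simp only [Finset.mul_sum, Finset.sum_mul]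
      have h2 : ((ssum p * W : ℝ) : ℂ) = 1 - ((ε * W : ℝ) : ℂ) := by
        rw [eq_sub_iff_add_eq, ← Complex.ofReal_add, ← add_mul, hW1, Complex.ofReal_one]
      rw [h1, h2]; ring
    change ‖2 * Real.pi * (g p * R ^ 2) - ∑ j, ((D j * ((s j * W : ℝ) : ℂ) +
        g p * ((2 * Real.pi * c j * W - 4 * Real.pi * s j ^ 2 * c j * W ^ 2 : ℝ) : ℂ)) * R +
        2 * Real.pi * (g p * ((s j ^ 2 * W : ℝ) : ℂ) * R ^ 2))‖ ≤ _
    rw [hid]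
    have hn := norm_nonneg R
    have b1 : ‖2 * Real.pi * g p * ((ε * W : ℝ) : ℂ) * R ^ 2‖ ≤ 2 * Real.pi * M * (W * ‖R‖) := by
      rw [norm_mul, norm_mul, norm_mul, norm_mul, norm_pow, Complex.norm_real, Complex.norm_real,
        Real.norm_of_nonneg hpi.le, Real.norm_of_nonneg (by positivity : 0 ≤ ε * W)]
      simp only [Complex.norm_ofNat]
      calc 2 * Real.pi * ‖g p‖ * (ε * W) * ‖R‖ ^ 2
          = 2 * Real.pi * ‖g p‖ * (W * ‖R‖) * (ε * ‖R‖) := by ring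
        _ ≤ 2 * Real.pi * M * (W * ‖R‖) * 1 := by
            apply mul_le_mul _ hεR (by positivity) (by positivity)
            have := hM p
            gcongr
        _ = _ := by ring
    have b2 : ∀ j ∈ Finset.univ, ‖(D j * ((s j * W : ℝ) : ℂ) +
        g p * ((2 * Real.pi * c j * W - 4 * Real.pi * s j ^ 2 * c j * W ^ 2 : ℝ) : ℂ)) * R‖ ≤
        M * (W * ‖R‖) * (1 + 2 * Real.pi + 4 * Real.pi * (s j ^ 2 * W)) := by
      intro j _
      rw [norm_mul]
      have c1 : ‖D j * ((s j * W : ℝ) : ℂ)‖ ≤ M * W := by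
        rw [norm_mul, Complex.norm_real, Real.norm_eq_abs, abs_mul, abs_of_pos hW0]
        refine mul_le_mul (hDM j) ?_ (by positivity) hM0
        have := hs1 j
        nlinarith
      have c2 : |2 * Real.pi * c j * W - 4 * Real.pi * s j ^ 2 * c j * W ^ 2| ≤
          W * (2 * Real.pi + 4 * Real.pi * (s j ^ 2 * W)) := by
        have : 2 * Real.pi * c j * W - 4 * Real.pi * s j ^ 2 * c j * W ^ 2 =
            c j * (W * (2 * Real.pi - 4 * Real.pi * (s j ^ 2 * W))) := by ring
        rw [this, abs_mul, abs_mul, abs_of_pos hW0]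
        have d1 : |2 * Real.pi - 4 * Real.pi * (s j ^ 2 * W)| ≤
            2 * Real.pi + 4 * Real.pi * (s j ^ 2 * W) := by
          have : 0 ≤ 4 * Real.pi * (s j ^ 2 * W) := by positivity
          rw [abs_le]; constructor <;> linarith
        calc _ ≤ 1 * (W * (2 * Real.pi + 4 * Real.pi * (s j ^ 2 * W))) := by
              apply mul_le_mul (hc1 j) _ (by positivity) zero_le_one
              gcongr
          _ = _ := one_mul _
      have c3 : ‖g p * ((2 * Real.pi * c j * W - 4 * Real.pi * s j ^ 2 * c j * W ^ 2 : ℝ) : ℂ)‖ ≤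
          M * (W * (2 * Real.pi + 4 * Real.pi * (s j ^ 2 * W))) := by
        rw [norm_mul, Complex.norm_real, Real.norm_eq_abs]
        exact mul_le_mul (hM p) c2 (abs_nonneg _) hM0
      calc _ ≤ (M * W + M * (W * (2 * Real.pi + 4 * Real.pi * (s j ^ 2 * W)))) * ‖R‖ :=
            mul_le_mul_of_nonneg_right ((norm_add_le _ _).trans (add_le_add c1 c3)) hn
        _ = _ := by ring
    refine (norm_sub_le _ _).trans ((add_le_add b1 (norm_sum_le_of_le _ b2)).trans ?_)
    have b3 : ∑ j, M * (W * ‖R‖) * (1 + 2 * Real.pi + 4 * Real.pi * (s j ^ 2 * W)) =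
        M * (W * ‖R‖) * (3 + 6 * Real.pi + 4 * Real.pi * (ssum p * W)) := by
      rw [hss, ← Finset.mul_sum, Finset.sum_add_distrib, ← Finset.mul_sum, ← Finset.sum_mul]
      simp only [Finset.sum_const, Finset.card_univ, Fintype.card_fin, nsmul_eq_mul]
      push_cast; ring
    rw [b3]
    have b4 : M * (W * ‖R‖) * (3 + 6 * Real.pi + 4 * Real.pi * (ssum p * W)) ≤
        M * (W * ‖R‖) * (3 + 6 * Real.pi + 4 * Real.pi * 1) := by gcongr
    linarith
  have hfin : ‖2 * Real.pi * ∫ p in T3, g p * resv α ε p ^ 2‖ ≤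
      (3 + 12 * Real.pi) * M * (12 * 56 * Real.pi * 24 * 24 * ε ^ (-(1/2) : ℝ)) := by
    rw [hIntEq]
    refine (norm_integral_le_lintegral_norm _).trans ?_
    apply ENNReal.toReal_le_of_le_ofReal (by positivity)
    calc _ ≤ ∫⁻ p in T3, ENNReal.ofReal ((3 + 12 * Real.pi) * M) *
          ENNReal.ofReal ((ssum p + ε)⁻¹ * ‖resv α ε p‖) := by
          refine lintegral_mono fun p => ?_
          rw [← ENNReal.ofReal_mul (by positivity)]
          exact ENNReal.ofReal_le_ofReal (hpt p)
      _ ≤ _ := by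
          rw [lintegral_const_mul' _ _ ENNReal.ofReal_ne_top,
            ENNReal.ofReal_mul (by positivity : 0 ≤ (3 + 12 * Real.pi) * M)]
          exact mul_le_mul_right (aux_K ε α hε) _
  rw [norm_mul, norm_mul, Complex.norm_real, Real.norm_of_nonneg hpi.le] at hfin
  simp only [Complex.norm_ofNat] at hfin
  have := norm_nonneg (∫ p in T3, g p * resv α ε p ^ 2)
  nlinarith

lemma C1Norm_bounds (g : (Fin 3 → ℝ) → ℂ) (hg : ContDiff ℝ 1 g) (hper : ZPeriodic g) :
    (∀ p, ‖g p‖ ≤ C1Norm g) ∧ ∀ p, ‖fderiv ℝ g p‖ ≤ C1Norm g := by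
  have key : ∀ f : (Fin 3 → ℝ) → ℝ, Continuous f →
      (∀ (p : Fin 3 → ℝ) (n : Fin 3 → ℤ), f (p + fun j => (n j : ℝ)) = f p) →
      BddAbove (Set.range f) := by
    intro f hf hp
    have hc : IsCompact (Set.Icc (0 : Fin 3 → ℝ) 1) := isCompact_Icc
    obtain ⟨B, hB⟩ := (hc.image hf).bddAbove
    refine ⟨B, ?_⟩
    rintro _ ⟨p, rfl⟩
    rw [← hp p (fun j => -⌊p j⌋)]
    apply hB
    refine ⟨_, ⟨fun j => ?_, fun j => ?_⟩, rfl⟩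
    · have := Int.floor_le (p j); simpa using this
    · have := Int.lt_floor_add_one (p j); simp; linarith
  have h1 := key (fun p => ‖g p‖) hg.continuous.norm (fun p n => by simp only [hper p n])
  have h2 := key (fun p => ‖fderiv ℝ g p‖) (hg.continuous_fderiv one_ne_zero).norm (fun p n => by
    have : (fun q => g (q + fun j => (n j : ℝ))) = g := funext fun q => hper q n
    have h := fderiv_comp_add_right (𝕜 := ℝ) (f := g) (x := p) (fun j => (n j : ℝ))
    rw [this] at h
    rw [← h])
  have e1 : ∀ p, ‖g p‖ ≤ ⨆ p, ‖g p‖ := fun p => le_ciSup h1 p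
  have e2 : ∀ p, ‖fderiv ℝ g p‖ ≤ ⨆ p, ‖fderiv ℝ g p‖ := fun p => le_ciSup h2 p
  have n1 := (norm_nonneg _).trans (e1 0)
  have n2 := (norm_nonneg _).trans (e2 0)
  unfold C1Norm
  exact ⟨fun p => by linarith [e1 p], fun p => by linarith [e2 p]⟩

/-- The resolvent integral as a function of a complex spectral parameter. -/
def Phi (g : (Fin 3 → ℝ) → ℂ) (z : ℂ) : ℂ := ∫ p in T3, (z - (edisp p : ℂ))⁻¹ * g p

lemma T3_compact : IsCompact T3 := by
  rw [T3, Set.pi_univ_Icc]; exact isCompact_Icc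

lemma den_im_le (z : ℂ) (x : ℝ) : z.im ≤ ‖z - (x : ℂ)‖ := by
  have h := Complex.abs_im_le_norm (z - (x : ℂ))
  simp at h
  exact (le_abs_self _).trans h

lemma den_ne (z : ℂ) (hz : 0 < z.im) (x : ℝ) : z - (x : ℂ) ≠ 0 := by
  have := den_im_le z x
  exact norm_pos_iff.1 (by linarith)

lemma edisp_ofReal_continuous : Continuous (fun p => (edisp p : ℂ)) :=
  Complex.continuous_ofReal.comp edisp_contDiff.continuous

lemma integrand_continuous (g : (Fin 3 → ℝ) → ℂ) (hg : Continuous g) (z : ℂ) (hz : 0 < z.im) :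
    Continuous (fun p => (z - (edisp p : ℂ))⁻¹ * g p) :=
  ((continuous_const.sub edisp_ofReal_continuous).inv₀ fun p => den_ne z hz _).mul hg

lemma Phi_deriv (g : (Fin 3 → ℝ) → ℂ) (hg : Continuous g) (M : ℝ) (hM : ∀ p, ‖g p‖ ≤ M)
    (z : ℂ) (hz : 0 < z.im) :
    HasDerivAt (Phi g) (∫ p in T3, -1 / (z - (edisp p : ℂ)) ^ 2 * g p) z := by
  have hM0 : 0 ≤ M := (norm_nonneg _).trans (hM 0)
  have hopen : IsOpen {w : ℂ | z.im / 2 < w.im} :=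
    isOpen_lt continuous_const Complex.continuous_im
  have hs : {w : ℂ | z.im / 2 < w.im} ∈ 𝓝 z := hopen.mem_nhds (by
    simp only [Set.mem_setOf_eq]; linarith)
  have hpos : ∀ w ∈ {w : ℂ | z.im / 2 < w.im}, 0 < w.im := fun w hw => by
    simp only [Set.mem_setOf_eq] at hw; linarith
  have hfin : IsFiniteMeasure ((volume : Measure (Fin 3 → ℝ)).restrict T3) :=
    ⟨by simpa using T3_compact.measure_lt_top⟩
  refine (hasDerivAt_integral_of_dominated_loc_of_deriv_le
    (F := fun w p => (w - (edisp p : ℂ))⁻¹ * g p)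
    (F' := fun w p => -1 / (w - (edisp p : ℂ)) ^ 2 * g p)
    (bound := fun _ => 1 / (z.im / 2) ^ 2 * M) hs ?_ ?_ ?_ ?_ ?_ ?_).2
  · filter_upwards [hs] with w hw
    exact (integrand_continuous g hg w (hpos w hw)).aestronglyMeasurable
  · exact (integrand_continuous g hg z hz).continuousOn.integrableOn_compact T3_compact
  · refine Continuous.aestronglyMeasurable ?_
    refine Continuous.mul (Continuous.div continuous_const
      ((continuous_const.sub edisp_ofReal_continuous).pow 2) fun p => ?_) hg
    exact pow_ne_zero _ (den_ne z hz _)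
  · refine Eventually.of_forall fun p w hw => ?_
    have h1 := den_im_le w (edisp p)
    have hw : z.im / 2 < w.im := hw
    rw [norm_mul, norm_div, norm_neg, norm_one, norm_pow]
    refine mul_le_mul ?_ (hM p) (norm_nonneg _) (by positivity)
    apply one_div_le_one_div_of_le (by positivity)
    exact pow_le_pow_left₀ (by positivity) (by linarith) 2
  · exact integrable_const _
  · refine Eventually.of_forall fun p w hw => ?_
    exact (((hasDerivAt_id w).sub_const (edisp p : ℂ)).fun_inv
      (den_ne w (hpos w hw) _)).mul_const (g p)

lemma Phi_deriv_bound (g : (Fin 3 → ℝ) → ℂ) (hg : ContDiff ℝ 1 g) (M : ℝ) (hM : ∀ p, ‖g p‖ ≤ M)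
    (hM' : ∀ p, ‖fderiv ℝ g p‖ ≤ M) (α ε : ℝ) (hε : 0 < ε) :
    ‖∫ p in T3, -1 / ((α : ℂ) + (ε : ℂ) * Complex.I - (edisp p : ℂ)) ^ 2 * g p‖ ≤
      (3 + 12 * Real.pi) * (12 * 56 * Real.pi * 24 * 24) * M * ε ^ (-(1/2) : ℝ) := by
  have h := aux_main g hg M hM hM' α ε hε
  have e : ∫ p in T3, -1 / ((α : ℂ) + (ε : ℂ) * Complex.I - (edisp p : ℂ)) ^ 2 * g p =
      - ∫ p in T3, g p * resv α ε p ^ 2 := by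
    rw [← integral_neg]
    congr 1
    funext p
    rw [resv, inv_pow, div_eq_mul_inv, show (α : ℂ) + (ε : ℂ) * Complex.I - (edisp p : ℂ) =
      (α : ℂ) - (edisp p : ℂ) + (ε : ℂ) * Complex.I by ring]
    ring
  rw [e, norm_neg]
  refine h.trans (le_of_eq (by ring))

/-- There exists `C > 0` such that for all `α, α' ∈ ℝ`, all `ε ≥ ε' > 0`,
and every `C¹` function `g : 𝕋³ → ℂ`,
`|∫_{𝕋³} [1/(α - e(p) + iε) - 1/(α' - e(p) + iε')] g(p) dp|
  ≤ C (ε^{-1/2} |α - α'| + ε^{1/2}) ‖g‖_{C¹}`. -/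
theorem statement0 :
    ∃ C : ℝ, 0 < C ∧
      ∀ α α' ε ε' : ℝ, 0 < ε' → ε' ≤ ε →
        ∀ g : (Fin 3 → ℝ) → ℂ, ContDiff ℝ 1 g → ZPeriodic g →
          ‖∫ p in T3,
              (((α : ℂ) - (edisp p : ℂ) + (ε : ℂ) * Complex.I)⁻¹ -
                ((α' : ℂ) - (edisp p : ℂ) + (ε' : ℂ) * Complex.I)⁻¹) * g p‖ ≤
            C * (ε ^ (-(1/2) : ℝ) * |α - α'| + ε ^ ((1/2) : ℝ)) * C1Norm g := by
  set K : ℝ := (3 + 12 * Real.pi) * (12 * 56 * Real.pi * 24 * 24) with hK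
  have hpi := Real.pi_pos
  have hK0 : 0 < K := by positivity
  refine ⟨2 * K, by positivity, ?_⟩
  intro α α' ε ε' hε' hεε g hg hper
  have hε : 0 < ε := lt_of_lt_of_le hε' hεε
  obtain ⟨hM, hM'⟩ := C1Norm_bounds g hg hper
  set M := C1Norm g with hMdef
  have hM0 : 0 ≤ M := (norm_nonneg _).trans (hM 0)
  have him : ∀ a b : ℝ, ((a : ℂ) + (b : ℂ) * Complex.I).im = b := fun a b => by simp
  have hsplit : ∫ p in T3,
      (((α : ℂ) - (edisp p : ℂ) + (ε : ℂ) * Complex.I)⁻¹ -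
        ((α' : ℂ) - (edisp p : ℂ) + (ε' : ℂ) * Complex.I)⁻¹) * g p =
      Phi g (α + ε * Complex.I) - Phi g (α' + ε' * Complex.I) := by
    unfold Phi
    rw [← integral_sub]
    · congr 1
      funext p
      rw [sub_mul, add_sub_right_comm, add_sub_right_comm]
    · exact (integrand_continuous g hg.continuous _
        (by rw [him]; exact hε)).continuousOn.integrableOn_compact T3_compact
    · exact (integrand_continuous g hg.continuous _
        (by rw [him]; exact hε')).continuousOn.integrableOn_compact T3_compact
  have hhor : ‖Phi g (α + ε * Complex.I) - Phi g (α' + ε * Complex.I)‖ ≤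
      K * M * ε ^ (-(1/2) : ℝ) * |α - α'| := by
    have hd : ∀ t ∈ (Set.univ : Set ℝ), HasDerivWithinAt
        (fun t : ℝ => Phi g ((t : ℂ) + ε * Complex.I))
        (∫ p in T3, -1 / ((t : ℂ) + (ε : ℂ) * Complex.I - (edisp p : ℂ)) ^ 2 * g p)
        Set.univ t := by
      intro t _
      have h1 := Phi_deriv g hg.continuous M hM ((t : ℂ) + ε * Complex.I) (by rw [him]; exact hε)
      have h2 := HasDerivAt.comp_add_const (t : ℂ) ((ε : ℂ) * Complex.I) h1
      exact h2.comp_ofReal.hasDerivWithinAt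
    have h := convex_univ.norm_image_sub_le_of_norm_hasDerivWithin_le hd
      (fun t _ => Phi_deriv_bound g hg M hM hM' t ε hε) (Set.mem_univ α') (Set.mem_univ α)
    simpa [Real.norm_eq_abs] using h
  have hver : ‖Phi g (α' + ε * Complex.I) - Phi g (α' + ε' * Complex.I)‖ ≤
      2 * (K * M) * ε ^ ((1/2) : ℝ) := by
    have hd : ∀ t : ℝ, 0 < t → HasDerivAt
        (fun t : ℝ => Phi g ((α' : ℂ) + t * Complex.I) - Phi g (α' + ε' * Complex.I))
        ((∫ p in T3, -1 / ((α' : ℂ) + (t : ℂ) * Complex.I - (edisp p : ℂ)) ^ 2 * g p) * Complex.I)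
        t := by
      intro t ht
      have h1 := Phi_deriv g hg.continuous M hM ((α' : ℂ) + t * Complex.I) (by rw [him]; exact ht)
      have h2 : HasDerivAt (fun w : ℂ => (α' : ℂ) + w * Complex.I) Complex.I (t : ℂ) := by
        simpa using ((hasDerivAt_id (t : ℂ)).mul_const Complex.I).const_add (α' : ℂ)
      have h3 := HasDerivAt.comp (t : ℂ) h1 h2
      exact (h3.comp_ofReal).sub_const _
    have hBd : ∀ t : ℝ, 0 < t → HasDerivAt
        (fun t : ℝ => 2 * (K * M) * t ^ ((1/2) : ℝ)) (K * M * t ^ (-(1/2) : ℝ)) t := by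
      intro t ht
      refine ((Real.hasDerivAt_rpow_const (p := (1/2 : ℝ)) (Or.inl ht.ne')).const_mul
        (2 * (K * M))).congr_deriv ?_
      norm_num
      ring
    refine image_norm_le_of_norm_deriv_right_le_deriv_boundary' (a := ε') (b := ε)
      (f := fun t : ℝ => Phi g ((α' : ℂ) + t * Complex.I) - Phi g (α' + ε' * Complex.I))
      (B := fun t : ℝ => 2 * (K * M) * t ^ ((1/2) : ℝ))
      (fun t ht => (hd t (hε'.trans_le ht.1)).continuousAt.continuousWithinAt)
      (fun t ht => (hd t (hε'.trans_le ht.1)).hasDerivWithinAt) ?_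
      (fun t ht => (hBd t (hε'.trans_le ht.1)).continuousAt.continuousWithinAt)
      (fun t ht => (hBd t (hε'.trans_le ht.1)).hasDerivWithinAt) ?_ ⟨hεε, le_rfl⟩
    · simp only [sub_self, norm_zero]
      positivity
    · intro t ht
      rw [norm_mul, Complex.norm_I, mul_one]
      exact Phi_deriv_bound g hg M hM hM' α' t (hε'.trans_le ht.1)
  rw [hsplit]
  have htri : Phi g (α + ε * Complex.I) - Phi g (α' + ε' * Complex.I) =
      (Phi g (α + ε * Complex.I) - Phi g (α' + ε * Complex.I)) +
      (Phi g (α' + ε * Complex.I) - Phi g (α' + ε' * Complex.I)) := by ring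
  rw [htri]
  refine (norm_add_le _ _).trans ((add_le_add hhor hver).trans ?_)
  have hx : 0 ≤ K * M * ε ^ (-(1/2) : ℝ) * |α - α'| := by positivity
  linarith

end
end

section
/- For every α ∈ ℝ the limit Θ(α) := lim_{ε→0⁺} Θ_ε(α) exists in ℂ, and there exists a constant C > 0 such that the limit function satisfies the Hölder estimate |Θ(a) − Θ(a′)| ≤ C |a − a′|^{1/2} for all a, a′ ∈ ℝ. -/
open MeasureTheory Filter Topology

noncomputable section

/-- The oscillatory phase `exp(i t cos θ)`. -/
def phs (t x : ℝ) : ℂ := Complex.exp (((t * Real.cos x : ℝ) : ℂ) * Complex.I)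

lemma phs_norm (t x : ℝ) : ‖phs t x‖ = 1 := Complex.norm_exp_ofReal_mul_I _

lemma phs_cont (t : ℝ) : Continuous (phs t) := by
  unfold phs; fun_prop

lemma phs_deriv (t x : ℝ) :
    HasDerivAt (phs t) (phs t x * ((-(t * Real.sin x) : ℝ) * Complex.I)) x := by
  have h1 : HasDerivAt (fun x : ℝ => t * Real.cos x) (-(t * Real.sin x)) x := by
    simpa using (Real.hasDerivAt_cos x).const_mul t
  exact (h1.ofReal_comp.mul_const Complex.I).cexp

lemma vdc_mid (t d : ℝ) (ht : 0 < t) (hd : 0 < d) (hd2 : d ≤ Real.pi / 2) :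
    ‖∫ x in d..(Real.pi - d), phs t x‖ ≤ 4 / (t * Real.sin d) := by
  have hpi := Real.pi_pos
  have hsd : 0 < Real.sin d := Real.sin_pos_of_pos_of_lt_pi hd (by linarith)
  have hle : d ≤ Real.pi - d := by linarith
  have hs : ∀ x ∈ Set.uIcc d (Real.pi - d), 0 < Real.sin x := by
    intro x hx
    rw [Set.uIcc_of_le hle] at hx
    exact Real.sin_pos_of_pos_of_lt_pi (by linarith [hx.1]) (by linarith [hx.2])
  have hcont2 : ContinuousOn (fun x => phs t x * ((Real.cos x / Real.sin x ^ 2 : ℝ) : ℂ))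
      (Set.uIcc d (Real.pi - d)) := by
    apply (phs_cont t).continuousOn.mul
    apply Complex.continuous_ofReal.comp_continuousOn
    exact Real.continuous_cos.continuousOn.div (by fun_prop)
      (fun x hx => (pow_pos (hs x hx) 2).ne')
  have hint2 := hcont2.intervalIntegrable (μ := volume)
  have hint1 : IntervalIntegrable (fun x => phs t x * ((-t : ℝ) * Complex.I)) volume d
      (Real.pi - d) := ((phs_cont t).mul continuous_const).intervalIntegrable _ _
  have hder : ∀ x ∈ Set.uIcc d (Real.pi - d),
      HasDerivAt (fun x => phs t x * (((Real.sin x)⁻¹ : ℝ) : ℂ))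
        (phs t x * ((-t : ℝ) * Complex.I) - phs t x * ((Real.cos x / Real.sin x ^ 2 : ℝ) : ℂ)) x := by
    intro x hx
    have h0 := (hs x hx).ne'
    have h1 : HasDerivAt (fun x => (Real.sin x)⁻¹) (-Real.cos x / Real.sin x ^ 2) x :=
      (Real.hasDerivAt_sin x).inv h0
    have h2 := (phs_deriv t x).mul h1.ofReal_comp
    refine h2.congr_deriv ?_
    have h0' : Complex.sin x ≠ 0 := by exact_mod_cast h0
    push_cast
    field_simp
    ring
  have hF := intervalIntegral.integral_eq_sub_of_hasDerivAt hder (hint1.sub hint2)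
  rw [intervalIntegral.integral_sub hint1 hint2, intervalIntegral.integral_mul_const] at hF
  have hcot : ∫ x in d..(Real.pi - d), 1 / Real.sin x ^ 2 = 2 * (Real.cos d / Real.sin d) := by
    have : ∀ x ∈ Set.uIcc d (Real.pi - d),
        HasDerivAt (fun x => - (Real.cos x / Real.sin x)) (1 / Real.sin x ^ 2) x := by
      intro x hx
      have h0 := (hs x hx).ne'
      refine ((Real.hasDerivAt_cos x).div (Real.hasDerivAt_sin x) h0).neg.congr_deriv ?_
      field_simp
      linarith [Real.sin_sq_add_cos_sq x]
    rw [intervalIntegral.integral_eq_sub_of_hasDerivAt this]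
    · simp; ring
    · apply ContinuousOn.intervalIntegrable
      exact continuousOn_const.div (by fun_prop) (fun x hx => (pow_pos (hs x hx) 2).ne')
  have hb2 : ‖∫ x in d..(Real.pi - d), phs t x * ((Real.cos x / Real.sin x ^ 2 : ℝ) : ℂ)‖
      ≤ 2 * (Real.cos d / Real.sin d) := by
    rw [← hcot]
    apply intervalIntegral.norm_integral_le_of_norm_le hle
    · filter_upwards with x hx
      rw [norm_mul, phs_norm, one_mul, Complex.norm_real, Real.norm_eq_abs, abs_div,
        abs_of_nonneg (sq_nonneg (Real.sin x))]
      gcongr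
      exact Real.abs_cos_le_one x
    · apply ContinuousOn.intervalIntegrable
      exact continuousOn_const.div (by fun_prop) (fun x hx => (pow_pos (hs x hx) 2).ne')
  have hend : ∀ x, Real.sin x = Real.sin d →
      ‖phs t x * (((Real.sin x)⁻¹ : ℝ) : ℂ)‖ = 1 / Real.sin d := by
    intro x hx
    rw [norm_mul, phs_norm, one_mul, Complex.norm_real, hx, Real.norm_of_nonneg (by positivity),
      one_div]
  have hcos : Real.cos d / Real.sin d ≤ 1 / Real.sin d := by
    gcongr; exact Real.cos_le_one d
  have key : ‖(∫ x in d..(Real.pi - d), phs t x) * ((-t : ℝ) * Complex.I)‖ ≤ 4 / Real.sin d := by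
    rw [sub_eq_iff_eq_add] at hF
    rw [hF]
    refine (norm_add_le _ _).trans ?_
    refine (add_le_add (norm_sub_le _ _) hb2).trans ?_
    rw [hend _ rfl, hend _ (Real.sin_pi_sub d)]
    have : 4 / Real.sin d = 4 * (1 / Real.sin d) := by ring
    linarith
  have hn : ‖((-t : ℝ) : ℂ) * Complex.I‖ = t := by
    simp [abs_of_pos ht]
  rw [norm_mul, hn, mul_comm] at key
  rw [mul_comm t, ← div_div, le_div_iff₀ ht, mul_comm]
  exact key

lemma vdc (t : ℝ) (ht : 0 < t) : ‖∫ x in (0:ℝ)..Real.pi, phs t x‖ ≤ 10 / √t := by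
  have hst : 0 < √t := Real.sqrt_pos.2 ht
  have h3 := Real.pi_gt_three
  have h4 : Real.pi < 3.15 := Real.pi_lt_d2
  rcases le_total t 1 with h | h
  · have : ‖∫ x in (0:ℝ)..Real.pi, phs t x‖ ≤ 1 * |Real.pi - 0| :=
      intervalIntegral.norm_integral_le_of_norm_le_const (fun x _ => (phs_norm t x).le)
    rw [sub_zero, abs_of_pos Real.pi_pos] at this
    have h1 : √t ≤ 1 := by simpa using Real.sqrt_le_sqrt h
    have : 10 ≤ 10 / √t := by rw [le_div_iff₀ hst]; linarith
    linarith
  · have h1 : 1 ≤ √t := by rw [Real.one_le_sqrt]; exact h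
    set d := 1 / √t with hd
    have hd0 : 0 < d := by positivity
    have hd1 : d ≤ 1 := by rw [hd, div_le_one hst]; exact h1
    have hi : ∀ a b, IntervalIntegrable (phs t) volume a b :=
      fun a b => (phs_cont t).intervalIntegrable _ _
    rw [← intervalIntegral.integral_add_adjacent_intervals (hi 0 d) (hi d Real.pi),
      ← intervalIntegral.integral_add_adjacent_intervals (hi d (Real.pi - d)) (hi _ Real.pi)]
    have a1 : ‖∫ x in (0:ℝ)..d, phs t x‖ ≤ 1 * |d - 0| :=
      intervalIntegral.norm_integral_le_of_norm_le_const (fun x _ => (phs_norm t x).le)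
    have a2 : ‖∫ x in (Real.pi - d)..Real.pi, phs t x‖ ≤ 1 * |Real.pi - (Real.pi - d)| :=
      intervalIntegral.norm_integral_le_of_norm_le_const (fun x _ => (phs_norm t x).le)
    have a3 := vdc_mid t d ht hd0 (by linarith)
    have a4 : 4 / (t * Real.sin d) ≤ 2 * Real.pi * d := by
      have h5 := Real.mul_le_sin hd0.le (by linarith)
      have h6 : t * (2 / Real.pi * d) ≤ t * Real.sin d := by gcongr
      refine (div_le_div_of_nonneg_left (by norm_num) (by positivity) h6).trans (le_of_eq ?_)
      have h7 : t = √t * √t := (Real.mul_self_sqrt ht.le).symm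
      rw [hd]
      nth_rw 1 [h7]
      field_simp
      ring
    rw [sub_zero, abs_of_pos hd0] at a1
    rw [sub_sub_cancel, abs_of_pos hd0] at a2
    have h8 : 10 / √t = 10 * d := by rw [hd]; ring
    rw [h8]
    refine (norm_add_le _ _).trans ?_
    refine (add_le_add_right (norm_add_le _ _) _).trans ?_
    nlinarith

/-- One-dimensional free propagator at the origin. -/
def Jt (t : ℝ) : ℂ :=
  ∫ p in (-(1/2) : ℝ)..(1/2), Complex.exp (((-(t * (1 - Real.cos (2 * Real.pi * p))) : ℝ) : ℂ) * Complex.I)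

lemma Jt_cont : Continuous Jt := by
  unfold Jt
  apply intervalIntegral.continuous_parametric_intervalIntegral_of_continuous'
  unfold Function.uncurry
  fun_prop

lemma Jt_le_one (t : ℝ) : ‖Jt t‖ ≤ 1 := by
  have : ‖Jt t‖ ≤ 1 * |(1/2:ℝ) - (-(1/2))| :=
    intervalIntegral.norm_integral_le_of_norm_le_const
      (fun x _ => (Complex.norm_exp_ofReal_mul_I _).le)
  norm_num at this
  exact this

lemma Jt_bound (t : ℝ) (ht : 0 < t) : ‖Jt t‖ ≤ 10 / √t := by
  have e1 : Jt t = Complex.exp (((-t : ℝ) : ℂ) * Complex.I) *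
      ∫ p in (-(1/2) : ℝ)..(1/2), phs t (2 * Real.pi * p) := by
    unfold Jt phs
    rw [← intervalIntegral.integral_const_mul]
    congr 1; ext p
    rw [← Complex.exp_add]
    congr 1
    push_cast; ring
  have hc : Continuous (fun p => phs t (2 * Real.pi * p)) := (phs_cont t).comp (by fun_prop)
  have e2 : ∫ p in (-(1/2) : ℝ)..0, phs t (2 * Real.pi * p) =
      ∫ p in (0:ℝ)..(1/2), phs t (2 * Real.pi * p) := by
    have := intervalIntegral.integral_comp_neg (a := 0) (b := 1/2)
      (fun p => phs t (2 * Real.pi * p))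
    rw [neg_zero] at this
    rw [← this]
    congr 1; ext p
    simp [phs]
  have e3 : ∫ p in (0:ℝ)..(1/2), phs t (2 * Real.pi * p) =
      (2 * Real.pi)⁻¹ • ∫ x in (0:ℝ)..Real.pi, phs t x := by
    rw [intervalIntegral.integral_comp_mul_left (phs t) (by positivity)]
    congr 2 <;> ring
  rw [e1, ← intervalIntegral.integral_add_adjacent_intervals (hc.intervalIntegrable _ 0)
    (hc.intervalIntegrable 0 _), e2, e3, norm_mul, Complex.norm_exp_ofReal_mul_I, one_mul]
  have hv := vdc t ht
  have h3 := Real.pi_gt_three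
  refine (norm_add_le _ _).trans ?_
  rw [norm_smul, Real.norm_of_nonneg (by positivity)]
  have : (2 * Real.pi)⁻¹ ≤ 1/2 := by
    rw [inv_le_comm₀ (by positivity) (by norm_num)]; norm_num; linarith
  have h0 := norm_nonneg (∫ x in (0:ℝ)..Real.pi, phs t x)
  nlinarith

lemma Jt3_bound (t : ℝ) (ht : 0 < t) : ‖Jt t ^ 3‖ ≤ 1000 * t ^ (-(3/2) : ℝ) := by
  rw [norm_pow]
  have h := pow_le_pow_left₀ (norm_nonneg _) (Jt_bound t ht) 3
  refine h.trans (le_of_eq ?_)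
  rw [div_pow, Real.rpow_neg ht.le, Real.sqrt_eq_rpow, ← Real.rpow_natCast (t ^ _),
    ← Real.rpow_mul ht.le]
  norm_num [div_eq_mul_inv]

lemma Jt3_int : IntegrableOn (fun t => Jt t ^ 3) (Set.Ioi (0:ℝ)) := by
  have hc : Continuous (fun t => Jt t ^ 3) := Jt_cont.pow 3
  rw [← Set.Ioc_union_Ioi_eq_Ioi (zero_le_one (α := ℝ))]
  refine IntegrableOn.union (hc.integrableOn_Ioc) ?_
  refine Integrable.mono' ((integrableOn_Ioi_rpow_of_lt (a := -(3/2)) (by norm_num)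
    one_pos).const_mul 1000) hc.aestronglyMeasurable ?_
  filter_upwards [ae_restrict_mem measurableSet_Ioi] with t ht
  exact Jt3_bound t (one_pos.trans ht)

lemma T3_fourier (t : ℝ) :
    ∫ q in T3, Complex.exp (((-(t * edisp q) : ℝ) : ℂ) * Complex.I) = Jt t ^ 3 := by
  have h1 : (volume.restrict T3 : Measure (Fin 3 → ℝ)) =
      Measure.pi (fun _ => volume.restrict (Set.Icc (-(1/2) : ℝ) (1/2))) := by
    rw [T3, volume_pi, Measure.restrict_pi_pi]
  have h2 : ∀ q : Fin 3 → ℝ, Complex.exp (((-(t * edisp q) : ℝ) : ℂ) * Complex.I) =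
      ∏ j, Complex.exp (((-(t * (1 - Real.cos (2 * Real.pi * q j))) : ℝ) : ℂ) * Complex.I) := by
    intro q
    rw [← Complex.exp_sum, edisp]
    congr 1
    rw [← Finset.sum_mul, ← Complex.ofReal_sum, Finset.mul_sum, Finset.sum_neg_distrib]
  simp_rw [h2]
  rw [h1, integral_fintype_prod_eq_prod (𝕜 := ℂ) (fun _ x =>
    Complex.exp (((-(t * (1 - Real.cos (2 * Real.pi * x))) : ℝ) : ℂ) * Complex.I))]
  rw [Finset.prod_const, Finset.card_univ, Fintype.card_fin, Jt,
    intervalIntegral.integral_of_le (by norm_num), integral_Icc_eq_integral_Ioc]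

lemma T3_finite : volume T3 < ⊤ := by
  have : IsCompact T3 := isCompact_univ_pi fun _ => isCompact_Icc
  exact this.measure_lt_top

lemma edisp_cont : Continuous edisp := by unfold edisp; fun_prop

lemma theta_rep (ε α : ℝ) (hε : 0 < ε) :
    ThetaEps ε α = -Complex.I * ∫ t in Set.Ioi (0:ℝ),
      Complex.exp (((-(ε * t) : ℝ) : ℂ) + ((t * α : ℝ) : ℂ) * Complex.I) * Jt t ^ 3 := by
  have hfin : IsFiniteMeasure (volume.restrict T3) :=
    ⟨by rw [Measure.restrict_apply_univ]; exact T3_finite⟩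
  have h1 : ∀ q : Fin 3 → ℝ, ((α : ℂ) - (edisp q : ℂ) + (ε : ℂ) * Complex.I)⁻¹ =
      -Complex.I * ∫ t in Set.Ioi (0:ℝ),
        Complex.exp ((((α - edisp q : ℝ) : ℂ) * Complex.I - (ε : ℂ)) * t) := by
    intro q
    have hre : ((((α - edisp q : ℝ) : ℂ) * Complex.I - (ε : ℂ))).re < 0 := by
      simp [hε]
    rw [integral_exp_mul_complex_Ioi hre]
    have h0 : (((α - edisp q : ℝ) : ℂ) * Complex.I - (ε : ℂ)) ≠ 0 := by
      intro h; rw [h] at hre; simp at hre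
    have hz : ((α : ℂ) - (edisp q : ℂ) + (ε : ℂ) * Complex.I) * Complex.I =
        (((α - edisp q : ℝ) : ℂ) * Complex.I - (ε : ℂ)) := by
      push_cast
      linear_combination (ε : ℂ) * Complex.I_mul_I
    have h0' : ((α : ℂ) - (edisp q : ℂ) + (ε : ℂ) * Complex.I) ≠ 0 := by
      intro h; rw [← hz, h, zero_mul] at h0; exact h0 rfl
    rw [← hz]
    simp
    have hI := Complex.I_ne_zero
    field_simp
  unfold ThetaEps
  simp_rw [h1]
  rw [integral_const_mul]
  congr 1
  rw [integral_integral_swap]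
  · congr 1; ext t
    rw [← T3_fourier, ← integral_const_mul]
    congr 1; ext q
    rw [← Complex.exp_add]
    congr 1
    push_cast; ring
  · have hexp : Integrable (fun t : ℝ => Real.exp (-ε * t)) (volume.restrict (Set.Ioi (0:ℝ))) :=
      integrableOn_exp_mul_Ioi (by linarith) 0
    refine Integrable.mono' (hexp.comp_snd (volume.restrict T3)) ?_ ?_
    · apply Continuous.aestronglyMeasurable
      have := edisp_cont
      unfold Function.uncurry
      fun_prop
    · filter_upwards with x
      simp [Function.uncurry, Complex.norm_exp]

/-- The limit function. -/
def ThetaLim (α : ℝ) : ℂ :=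
  -Complex.I * ∫ t in Set.Ioi (0:ℝ), Complex.exp (((t * α : ℝ) : ℂ) * Complex.I) * Jt t ^ 3

lemma theta_lim : IsThetaLimit ThetaLim := by
  intro α
  have h1 : (fun ε => -Complex.I * ∫ t in Set.Ioi (0:ℝ),
      Complex.exp (((-(ε * t) : ℝ) : ℂ) + ((t * α : ℝ) : ℂ) * Complex.I) * Jt t ^ 3) =ᶠ[𝓝[>] (0:ℝ)]
      (fun ε => ThetaEps ε α) := by
    filter_upwards [self_mem_nhdsWithin] with ε hε
    exact (theta_rep ε α hε).symm
  refine Tendsto.congr' h1 ?_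
  apply Tendsto.const_mul
  have hJ := Jt_cont
  refine tendsto_integral_filter_of_dominated_convergence (fun t => ‖Jt t ^ 3‖) ?_ ?_
    Jt3_int.norm ?_
  · filter_upwards with ε
    apply Continuous.aestronglyMeasurable
    fun_prop
  · filter_upwards [self_mem_nhdsWithin] with ε hε
    filter_upwards [ae_restrict_mem measurableSet_Ioi] with t ht
    rw [norm_mul, Complex.norm_exp]
    refine mul_le_of_le_one_left (norm_nonneg _) ?_
    rw [Real.exp_le_one_iff]
    have : 0 < ε * t := mul_pos hε ht
    simpa using this.le
  · filter_upwards with t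
    have hc : Continuous (fun ε : ℝ =>
      Complex.exp (((-(ε * t) : ℝ) : ℂ) + ((t * α : ℝ) : ℂ) * Complex.I) * Jt t ^ 3) := by fun_prop
    have := (hc.tendsto 0).mono_left (nhdsWithin_le_nhds (s := Set.Ioi (0:ℝ)))
    simpa using this

lemma exp_diff (t a a' : ℝ) :
    ‖Complex.exp (((t * a : ℝ) : ℂ) * Complex.I) - Complex.exp (((t * a' : ℝ) : ℂ) * Complex.I)‖
      ≤ |t| * |a - a'| := by
  have : Complex.exp (((t * a : ℝ) : ℂ) * Complex.I) - Complex.exp (((t * a' : ℝ) : ℂ) * Complex.I)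
      = Complex.exp (((t * a' : ℝ) : ℂ) * Complex.I) *
        (Complex.exp (Complex.I * ((t * (a - a') : ℝ) : ℂ)) - 1) := by
    rw [mul_sub, ← Complex.exp_add, mul_one]
    congr 2
    push_cast; ring
  rw [this, norm_mul, Complex.norm_exp_ofReal_mul_I, one_mul, ← abs_mul]
  exact Real.norm_exp_I_mul_ofReal_sub_one_le

lemma exp_diff_two (t a a' : ℝ) :
    ‖Complex.exp (((t * a : ℝ) : ℂ) * Complex.I) - Complex.exp (((t * a' : ℝ) : ℂ) * Complex.I)‖
      ≤ 2 := by
  refine (norm_sub_le _ _).trans ?_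
  rw [Complex.norm_exp_ofReal_mul_I, Complex.norm_exp_ofReal_mul_I]; norm_num

lemma theta_holder (a a' : ℝ) : ‖ThetaLim a - ThetaLim a'‖ ≤ 6000 * |a - a'| ^ ((1/2) : ℝ) := by
  rcases eq_or_ne a a' with rfl | hne
  · simp
  set D := |a - a'| with hD
  have hDpos : 0 < D := abs_pos.2 (sub_ne_zero.2 hne)
  have hJ := Jt_cont
  have hint : ∀ b : ℝ, IntegrableOn (fun t : ℝ =>
      Complex.exp (((t * b : ℝ) : ℂ) * Complex.I) * Jt t ^ 3) (Set.Ioi 0) := by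
    intro b
    refine Integrable.mono Jt3_int (Continuous.aestronglyMeasurable (by fun_prop)) ?_
    filter_upwards with t
    rw [norm_mul, Complex.norm_exp_ofReal_mul_I, one_mul]
  set F : ℝ → ℂ := fun t => Complex.exp (((t * a : ℝ) : ℂ) * Complex.I) * Jt t ^ 3 -
    Complex.exp (((t * a' : ℝ) : ℂ) * Complex.I) * Jt t ^ 3 with hF
  have hFint : IntegrableOn F (Set.Ioi 0) := (hint a).sub (hint a')
  have e1 : ThetaLim a - ThetaLim a' = -Complex.I * ∫ t in Set.Ioi (0:ℝ), F t := by
    rw [hF, integral_sub (hint a) (hint a'), ThetaLim, ThetaLim, mul_sub]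
  have hFn : ∀ t, ‖F t‖ = ‖Complex.exp (((t * a : ℝ) : ℂ) * Complex.I) -
      Complex.exp (((t * a' : ℝ) : ℂ) * Complex.I)‖ * ‖Jt t ^ 3‖ := by
    intro t; rw [hF, ← norm_mul, sub_mul]
  have hc : 0 < D⁻¹ := by positivity
  rw [e1, norm_mul, norm_neg, Complex.norm_I, one_mul, ← Set.Ioc_union_Ioi_eq_Ioi hc.le,
    setIntegral_union (Set.Ioc_disjoint_Ioi le_rfl) measurableSet_Ioi
      (hFint.mono_set Set.Ioc_subset_Ioi_self) (hFint.mono_set (Set.Ioi_subset_Ioi hc.le))]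
  have hDD : (D⁻¹) ^ ((1/2) : ℝ) * D = D ^ ((1/2) : ℝ) := by
    rw [Real.inv_rpow hDpos.le, ← Real.rpow_neg hDpos.le]
    nth_rw 2 [← Real.rpow_one D]
    rw [← Real.rpow_add hDpos]; norm_num
  have b1 : ‖∫ t in Set.Ioc 0 D⁻¹, F t‖ ≤ 2000 * D ^ ((1/2) : ℝ) := by
    have hi : IntegrableOn (fun t : ℝ => 1000 * D * t ^ (-(1/2) : ℝ)) (Set.Ioc 0 D⁻¹) := by
      have := intervalIntegral.intervalIntegrable_rpow' (a := 0) (b := D⁻¹)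
        (r := -(1/2)) (by norm_num)
      rw [intervalIntegrable_iff_integrableOn_Ioc_of_le hc.le] at this
      exact this.const_mul _
    refine (norm_integral_le_of_norm_le hi ?_).trans (le_of_eq ?_)
    · filter_upwards [ae_restrict_mem measurableSet_Ioc] with t ht
      rw [hFn]
      have ht0 : 0 < t := ht.1
      have h1 := exp_diff t a a'
      rw [abs_of_pos ht0] at h1
      refine (mul_le_mul h1 (Jt3_bound t ht0) (norm_nonneg _) (by positivity)).trans (le_of_eq ?_)
      have : t ^ (-(1/2) : ℝ) = t * t ^ (-(3/2) : ℝ) := by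
        nth_rw 2 [← Real.rpow_one t]
        rw [← Real.rpow_add ht0]; norm_num
      rw [this]; ring
    · rw [integral_const_mul, ← intervalIntegral.integral_of_le hc.le,
        integral_rpow (Or.inl (by norm_num))]
      rw [← hDD]
      norm_num
      ring
  have b2 : ‖∫ t in Set.Ioi D⁻¹, F t‖ ≤ 4000 * D ^ ((1/2) : ℝ) := by
    have hi : IntegrableOn (fun t : ℝ => 2000 * t ^ (-(3/2) : ℝ)) (Set.Ioi D⁻¹) :=
      (integrableOn_Ioi_rpow_of_lt (by norm_num) hc).const_mul _
    refine (norm_integral_le_of_norm_le hi ?_).trans (le_of_eq ?_)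
    · filter_upwards [ae_restrict_mem measurableSet_Ioi] with t ht
      rw [hFn]
      have ht0 : 0 < t := hc.trans ht
      refine (mul_le_mul (exp_diff_two t a a') (Jt3_bound t ht0) (norm_nonneg _)
        (by positivity)).trans (le_of_eq ?_)
      ring
    · rw [integral_const_mul, integral_Ioi_rpow_of_lt (by norm_num) hc]
      rw [Real.inv_rpow hDpos.le, ← Real.rpow_neg hDpos.le]
      norm_num
      ring
  refine (norm_add_le _ _).trans ?_
  linarith

/-- The limit `Θ(α) = lim_{ε→0⁺} Θ_ε(α)` exists for every `α ∈ ℝ`, and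
there is `C > 0` with `|Θ(a) - Θ(a')| ≤ C |a - a'|^{1/2}` for all `a, a' ∈ ℝ`. -/
theorem statement1 :
    ∃ Θ : ℝ → ℂ, IsThetaLimit Θ ∧
      ∃ C : ℝ, 0 < C ∧ ∀ a a' : ℝ, ‖Θ a - Θ a'‖ ≤ C * |a - a'| ^ ((1/2) : ℝ) :=
  ⟨ThetaLim, theta_lim, 6000, by norm_num, theta_holder⟩

end
end
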